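/- arXiv:1710.00394 — 5 statements merged into one kernel-verified Lean document; each statement's English description precedes it below -/
import Mathlib

section
/- Let D be a bounded ℂ-convex domain in ℂ^{n+m} that is strictly ℂ-convex and strongly normal, and let π : ℂ^{n+m} → ℂⁿ be the projection onto the first n coordinates. Then the shadow π(D) is a strongly normal domain in ℂⁿ. -/
open Set Topology Filter

noncomputable section

variable {E : Type*} [NormedAddCommGroup E] [NormedSpace ℂ E]

/-- A complex affine line in a complex normed space. -/
def IsComplexAffineLine (L : Set E) : Prop :=
  ∃ a v : E, v ≠ 0 ∧ L = {x | ∃ t : ℂ, x = a + t • v}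

/-- A complex affine hyperplane: a level set of a nonzero continuous ℂ-linear functional. -/
def IsComplexAffineHyperplane (H : Set E) : Prop :=
  ∃ (f : E →L[ℂ] ℂ) (c : ℂ), f ≠ 0 ∧ H = {x | f x = c}

/-- A domain `D` is ℂ-convex if its intersection with every complex affine line meeting it
is connected and simply connected. -/
def IsCConvex (D : Set E) : Prop :=
  ∀ L : Set E, IsComplexAffineLine L → (L ∩ D).Nonempty →
    IsConnected (L ∩ D) ∧ SimplyConnectedSpace ↥(L ∩ D)

/-- `p` is an extreme ℂ-convex boundary point of `D`. -/
def ExtremeCConvexAt (D : Set E) (p : E) : Prop :=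
  ∃ H : Set E, IsComplexAffineHyperplane H ∧ p ∈ H ∧
    ∃ U : Set E, IsOpen U ∧ p ∈ U ∧ H ∩ closure D ∩ U = {p}

/-- `p` is a globally extreme ℂ-convex boundary point of `D`. -/
def GloballyExtremeCConvexAt (D : Set E) (p : E) : Prop :=
  ∃ H : Set E, IsComplexAffineHyperplane H ∧ p ∈ H ∧ H ∩ closure D = {p}

/-- `p` is a strictly ℂ-convex boundary point of `D`. -/
def StrictlyCConvexAt (D : Set E) (p : E) : Prop :=
  ∃ U : Set E, IsOpen U ∧ p ∈ U ∧
    ∀ H : Set E, IsComplexAffineHyperplane H → p ∈ H → H ∩ D = ∅ →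
      U ∩ closure D ∩ H = {p}

/-- `p` is a globally strictly ℂ-convex boundary point of `D`. -/
def GloballyStrictlyCConvexAt (D : Set E) (p : E) : Prop :=
  ∀ H : Set E, IsComplexAffineHyperplane H → p ∈ H → H ∩ D = ∅ →
    closure D ∩ H = {p}

/-- `p` is a normal boundary point of `D`. -/
def NormalAt (D : Set E) (p : E) : Prop :=
  ∀ U : Set E, IsOpen U → p ∈ U →
    ∃ V : Set E, IsOpen V ∧ p ∈ V ∧ V ⊆ U ∧
      ∀ x ∈ V ∩ D, ∀ y ∈ V ∩ D, JoinedIn (U ∩ D) x y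

/-- `p` is a strongly normal boundary point of `D`. -/
def StronglyNormalAt (D : Set E) (p : E) : Prop :=
  ∀ U : Set E, IsOpen U → p ∈ U →
    ∃ V : Set E, IsOpen V ∧ p ∈ V ∧ V ⊆ U ∧ IsConnected (V ∩ D)

/-- The Wirtinger-type derivative `∂ρ(z)(X) = (dρ(z)(X) - i·dρ(z)(iX))/2` of a real-valued
function; for `ρ` real-valued this is the complex-linear part of the real differential, so that
`∂ρ(z)(X) = Σ_j (∂ρ/∂z_j)(z)·X_j` in coordinates. -/
def wirtingerDeriv (ρ : E → ℝ) (z X : E) : ℂ :=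
  (((fderiv ℝ ρ z X : ℝ) : ℂ) - Complex.I * ((fderiv ℝ ρ z (Complex.I • X) : ℝ) : ℂ)) / 2

/-- The second (real) derivative `D²ρ(z)(X,Y)`. -/
def secondDerivAt (ρ : E → ℝ) (z X Y : E) : ℝ :=
  fderiv ℝ (fderiv ℝ ρ) z X Y

/-- `U`, `ρ`, `c` witness that the bounded domain `D` is a `C^k`-smooth strongly linearly
convex domain. -/
def IsSLCDefiningData (k : ℕ∞) (D U : Set E) (ρ : E → ℝ) (c : ℝ) : Prop :=
  IsOpen U ∧ frontier D ⊆ U ∧ ContDiffOn ℝ k ρ U ∧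
  frontier D = {z ∈ U | ρ z = 0} ∧ D ∩ U = {z ∈ U | ρ z < 0} ∧
  (∀ z ∈ U, fderiv ℝ ρ z ≠ 0) ∧ 0 < c ∧
  (∀ z ∈ frontier D, ∀ X : E, wirtingerDeriv ρ z X = 0 →
    c * ‖X‖ ^ 2 ≤ secondDerivAt ρ z X X)

end

/-- Every nonempty slice of `G` by a parametrized complex line is simply connected. -/
def HasSimplyConnectedSlices {V : Type*} [AddCommGroup V] [Module ℂ V] (G : Set V) : Prop :=
  ∀ x v : V, {s : ℂ | x + s • v ∈ G}.Nonempty → IsSimplyConnected {s : ℂ | x + s • v ∈ G}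

theorem isSimplyConnected_univ_complex : IsSimplyConnected (univ : Set ℂ) := by
  have : SimplyConnectedSpace ℂ := inferInstance
  exact ((Homeomorph.Set.univ ℂ).toHomotopyEquiv.simplyConnectedSpace :
    SimplyConnectedSpace (univ : Set ℂ))

theorem IsCConvex.hasSimplyConnectedSlices {V : Type*} [NormedAddCommGroup V] [NormedSpace ℂ V]
    {D : Set V} (hD : IsCConvex D) : HasSimplyConnectedSlices D := by
  intro x v hne
  obtain ⟨s₀, hs₀⟩ := hne
  rcases eq_or_ne v 0 with rfl | hv
  · have hx : x ∈ D := by simpa using hs₀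
    simpa [hx] using isSimplyConnected_univ_complex
  · have himg : (fun s : ℂ => x + s • v) '' {s : ℂ | x + s • v ∈ D} =
        {y | ∃ t : ℂ, y = x + t • v} ∩ D := by
      ext y
      constructor
      · rintro ⟨s, hs, rfl⟩
        exact ⟨⟨s, rfl⟩, hs⟩
      · rintro ⟨⟨s, rfl⟩, hs⟩
        exact ⟨s, hs, rfl⟩
    have hemb : IsEmbedding (fun s : ℂ => x + s • v) :=
      ((Homeomorph.addLeft x).isEmbedding).comp (isClosedEmbedding_smul_left hv).isEmbedding
    rw [← hemb.isSimplyConnected_image, himg]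
    exact (hD _ ⟨x, v, hv, rfl⟩ ⟨x + s₀ • v, ⟨s₀, rfl⟩, hs₀⟩).2

theorem HasSimplyConnectedSlices.preimage {V W : Type*} [AddCommGroup V] [Module ℂ V]
    [AddCommGroup W] [Module ℂ W] {G : Set W} (hG : HasSimplyConnectedSlices G)
    (f : V →ₗ[ℂ] W) (c : W) : HasSimplyConnectedSlices {x | c + f x ∈ G} := by
  intro x v
  simpa [add_assoc] using hG (c + f x) (f v)

theorem HasSimplyConnectedSlices.isPreconnected {V : Type*} [NormedAddCommGroup V]
    [NormedSpace ℂ V] {G : Set V} (hG : HasSimplyConnectedSlices G) : IsPreconnected G := by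
  refine isPreconnected_of_forall_pair fun x hx y hy => ?_
  have h0 : (0 : ℂ) ∈ {s : ℂ | x + s • (y - x) ∈ G} := by simpa using hx
  refine ⟨(fun s : ℂ => x + s • (y - x)) '' {s : ℂ | x + s • (y - x) ∈ G}, ?_, ⟨0, h0, by simp⟩,
    ⟨1, by simpa using hy, by simp⟩, ?_⟩
  · rintro _ ⟨s, hs, rfl⟩
    exact hs
  · exact (hG x (y - x) ⟨0, h0⟩).isPathConnected.isConnected.isPreconnected.image _
      (by fun_prop)

/-- Two continuous logarithms of the same function on a preconnected set differ by a constant. -/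
theorem IsPreconnected.sub_eq_sub_of_exp_eq {T : Type*} [TopologicalSpace T] {s : Set T}
    (hs : IsPreconnected s) {f g : T → ℂ} (hf : ContinuousOn f s) (hg : ContinuousOn g s)
    (h : ∀ x ∈ s, Complex.exp (f x) = Complex.exp (g x)) {x y : T} (hx : x ∈ s) (hy : y ∈ s) :
    f x - g x = f y - g y := by
  have key : ∀ z ∈ s, ∃ n : ℤ, (f z - g z) / (2 * Real.pi * Complex.I) = n := by
    intro z hz
    obtain ⟨n, hn⟩ := Complex.exp_eq_exp_iff_exists_int.1 (h z hz)
    exact ⟨n, by rw [hn, add_sub_cancel_left, mul_div_assoc, div_self Complex.two_pi_I_ne_zero,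
      mul_one]⟩
  have hcont : ContinuousOn (fun z => ((f z - g z) / (2 * Real.pi * Complex.I)).re) s :=
    Complex.continuous_re.comp_continuousOn ((hf.sub hg).div_const _)
  have hmaps : MapsTo (fun z => ((f z - g z) / (2 * Real.pi * Complex.I)).re) s
      (range ((↑) : ℤ → ℝ)) := by
    intro z hz
    obtain ⟨n, hn⟩ := key z hz
    exact ⟨n, by simp [hn]⟩
  have := hs.constant_of_mapsTo Int.isClosedEmbedding_coe_real.isInducing.isDiscrete_range
    hcont hmaps hx hy
  obtain ⟨a, ha⟩ := key x hx
  obtain ⟨b, hb⟩ := key y hy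
  have hab : a = b := by simpa [ha, hb] using this
  have : (f x - g x) / (2 * Real.pi * Complex.I) = (f y - g y) / (2 * Real.pi * Complex.I) := by
    rw [ha, hb, hab]
  exact (div_left_inj' Complex.two_pi_I_ne_zero).1 this

theorem exists_local_log {T : Type*} [TopologicalSpace T] {X : Set T} (hX : IsOpen X) {g : T → ℂ}
    (hg : ContinuousOn g X) (hg0 : ∀ x ∈ X, g x ≠ 0) {x₀ : T} (hx₀ : x₀ ∈ X) :
    ∃ U ⊆ X, IsOpen U ∧ x₀ ∈ U ∧ ∃ ψ : T → ℂ, ContinuousOn ψ U ∧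
      ∀ x ∈ U, Complex.exp (ψ x) = g x := by
  have hq : ContinuousOn (fun x => g x / g x₀) X := hg.div_const _
  refine ⟨X ∩ (fun x => g x / g x₀) ⁻¹' Complex.slitPlane, inter_subset_left,
    hq.isOpen_inter_preimage hX Complex.isOpen_slitPlane,
    ⟨hx₀, by simp [div_self (hg0 x₀ hx₀)]⟩,
    fun x => Complex.log (g x / g x₀) + Complex.log (g x₀), ?_, ?_⟩
  · exact ((hq.mono inter_subset_left).clog fun x hx => hx.2).add continuousOn_const
  · intro x hx
    rw [Complex.exp_add, Complex.exp_log (div_ne_zero (hg0 x hx.1) (hg0 x₀ hx₀)),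
      Complex.exp_log (hg0 x₀ hx₀), div_mul_cancel₀ _ (hg0 x₀ hx₀)]

/-- A fibrewise continuous logarithm that is continuous along one horizontal section through a
connected fibre is jointly continuous at every point of that fibre. -/
theorem continuousAt_of_fiberwise_log {Y Z : Type*} [TopologicalSpace Y] [TopologicalSpace Z]
    [LocallyConnectedSpace Z] {X : Set (Y × Z)} (hX : IsOpen X) {g : Y × Z → ℂ}
    (hg : ContinuousOn g X) (hg0 : ∀ p ∈ X, g p ≠ 0) {L : Y × Z → ℂ} {y₀ : Y}
    (hL : ∀ᶠ y in 𝓝 y₀, ContinuousOn (fun z => L (y, z)) {z | (y, z) ∈ X})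
    (hexp : ∀ᶠ y in 𝓝 y₀, ∀ z, (y, z) ∈ X → Complex.exp (L (y, z)) = g (y, z))
    (hpre : IsPreconnected {z | (y₀, z) ∈ X}) {z₀ z : Z} (hz₀ : (y₀, z₀) ∈ X)
    (hcont : ContinuousAt (fun y => L (y, z₀)) y₀) (hz : (y₀, z) ∈ X) :
    ContinuousAt L (y₀, z) := by
  have loc : ∀ z₁, (y₀, z₁) ∈ X → ∃ B : Set Z, IsOpen B ∧ z₁ ∈ B ∧ ∃ ψ : Y × Z → ℂ,
      (∀ z ∈ B, ContinuousAt ψ (y₀, z)) ∧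
      ∀ᶠ y in 𝓝 y₀, ∀ z ∈ B, ∀ z' ∈ B, L (y, z) - ψ (y, z) = L (y, z') - ψ (y, z') := by
    intro z₁ hz₁
    obtain ⟨U, hUX, hU, hzU, ψ, hψ, hψe⟩ := exists_local_log hX hg hg0 hz₁
    obtain ⟨N, hN, B, hB, hNB⟩ := mem_nhds_prod_iff.1 (hU.mem_nhds hzU)
    obtain ⟨B', hB'B, hB', hzB', hB'c⟩ :=
      locallyConnectedSpace_iff_subsets_isOpen_isConnected.1 ‹_› z₁ B hB
    have hsub : ∀ y ∈ N, ∀ z ∈ B', (y, z) ∈ U := fun y hy z hz => hNB ⟨hy, hB'B hz⟩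
    refine ⟨B', hB', hzB', ψ, fun z hz => hψ.continuousAt
      (hU.mem_nhds (hsub _ (mem_of_mem_nhds hN) z hz)), ?_⟩
    filter_upwards [hN, hL, hexp] with y hy hLy hey z hz z' hz'
    refine hB'c.isPreconnected.sub_eq_sub_of_exp_eq (f := fun z => L (y, z))
      (g := fun z => ψ (y, z)) (hLy.mono fun z hz => hUX (hsub y hy z hz)) ?_ ?_ hz hz'
    · exact hψ.comp (by fun_prop) fun z hz => hsub y hy z hz
    · intro z hz
      rw [hey z (hUX (hsub y hy z hz)), hψe _ (hsub y hy z hz)]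
  have horiz : ∀ {ψ : Y × Z → ℂ} {z : Z}, ContinuousAt ψ (y₀, z) →
      ContinuousAt (fun y => ψ (y, z)) y₀ := fun h =>
    ContinuousAt.comp (f := fun y => (y, _)) h (by fun_prop)
  have hall : ContinuousAt (fun y => L (y, z)) y₀ := by
    refine (hpre.induction₂ (fun a b => ContinuousAt (fun y => L (y, a)) y₀ ↔
      ContinuousAt (fun y => L (y, b)) y₀) ?_ (fun _ _ _ _ _ _ h h' => h.trans h')
      (fun _ _ _ _ h => h.symm) hz₀ hz).1 hcont
    intro z₁ hz₁
    obtain ⟨B, hB, hzB, ψ, hψ, hev⟩ := loc z₁ hz₁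
    have step : ∀ a ∈ B, ∀ b ∈ B, ContinuousAt (fun y => L (y, a)) y₀ →
        ContinuousAt (fun y => L (y, b)) y₀ := by
      intro a ha b hb h
      refine ((h.sub (horiz (hψ a ha))).add (horiz (hψ b hb))).congr ?_
      filter_upwards [hev] with y hy
      rw [Pi.add_apply, Pi.sub_apply, hy a ha b hb, sub_add_cancel]
    filter_upwards [mem_nhdsWithin_of_mem_nhds (hB.mem_nhds hzB)] with b hb
    exact ⟨step _ hzB _ hb, step _ hb _ hzB⟩
  obtain ⟨B, hB, hzB, ψ, hψ, hev⟩ := loc z hz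
  have hfst : ContinuousAt (fun p : Y × Z => L (p.1, z) - ψ (p.1, z)) (y₀, z) :=
    ContinuousAt.comp (f := Prod.fst) (g := fun y => L (y, z) - ψ (y, z))
      (hall.sub (horiz (hψ z hzB))) continuousAt_fst
  refine (hfst.add (hψ z hzB)).congr ?_
  rw [nhds_prod_eq]
  filter_upwards [hev.prod_mk (hB.mem_nhds hzB)] with p hp
  rw [Pi.add_apply, hp.1 z hzB p.2 hp.2, sub_add_cancel]

theorem HasSimplyConnectedSlices.exists_log {V : Type*} [NormedAddCommGroup V]
    [NormedSpace ℂ V] {G : Set V} (hG : HasSimplyConnectedSlices G) (hGo : IsOpen G) {g : V → ℂ}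
    (hg : ContinuousOn g G) (hg0 : ∀ x ∈ G, g x ≠ 0) :
    ∃ L : V → ℂ, ContinuousOn L G ∧ ∀ x ∈ G, Complex.exp (L x) = g x := by
  rcases G.eq_empty_or_nonempty with rfl | ⟨x₀, hx₀⟩
  · exact ⟨0, by simp, by simp⟩
  have hopen : ∀ v : V, IsOpen {s : ℂ | x₀ + s • v ∈ G} := fun v =>
    hGo.preimage (by fun_prop)
  have h0 : ∀ v : V, (0 : ℂ) ∈ {s : ℂ | x₀ + s • v ∈ G} := fun v => by simpa using hx₀
  have hsc : ∀ v : V, IsSimplyConnected {s : ℂ | x₀ + s • v ∈ G} := fun v => hG x₀ v ⟨0, h0 v⟩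
  have hlog : ∀ v : V, ∃ f : ℂ → ℂ, ContinuousOn f {s : ℂ | x₀ + s • v ∈ G} ∧
      EqOn (Complex.exp ∘ f) (fun s => g (x₀ + s • v)) {s : ℂ | x₀ + s • v ∈ G} := fun v =>
    Complex.exists_continuousOn_eqOn_exp_comp (hsc v) (hopen v)
      (hg.comp (by fun_prop) fun s hs => hs) (by
        rintro ⟨s, hs, h⟩
        exact hg0 _ hs h)
  choose f hf hfe using hlog
  let X : Set (V × ℂ) := {p | x₀ + p.2 • p.1 ∈ G}
  let L : V × ℂ → ℂ := fun p => f p.1 p.2 - f p.1 0 + Complex.log (g x₀)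
  have hLe : ∀ v s, (v, s) ∈ X → Complex.exp (L (v, s)) = g (x₀ + s • v) := by
    intro v s hs
    have h1 : Complex.exp (f v s) = g (x₀ + s • v) := hfe v hs
    have h2 : Complex.exp (f v 0) = g x₀ := by simpa using hfe v (h0 v)
    simp only [L]
    rw [Complex.exp_add, Complex.exp_sub, h1, h2, Complex.exp_log (hg0 _ hx₀),
      div_mul_cancel₀ _ (hg0 _ hx₀)]
  have hmem : ∀ x ∈ G, (x - x₀, (1 : ℂ)) ∈ X := fun x hx => by simpa [X] using hx
  refine ⟨fun x => L (x - x₀, 1), ?_, fun x hx => by simpa using hLe _ _ (hmem x hx)⟩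
  intro x hx
  have hLc : ContinuousAt L (x - x₀, 1) := by
    refine continuousAt_of_fiberwise_log (X := X) (g := fun p => g (x₀ + p.2 • p.1)) (z₀ := 0)
      (hGo.preimage (by fun_prop)) (hg.comp (by fun_prop) fun p hp => hp) (fun p hp => hg0 _ hp)
      (Eventually.of_forall fun v => ?_) (Eventually.of_forall fun v s hs => hLe v s hs)
      (hsc _).isPathConnected.isConnected.isPreconnected (h0 _) ?_ (hmem x hx)
    · exact ((hf v).sub (continuousOn_const (c := f v 0))).add
        (continuousOn_const (c := Complex.log (g x₀)))
    · simpa [L] using continuousAt_const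
  exact (ContinuousAt.comp (f := fun x : V => (x - x₀, (1 : ℂ))) hLc
    (by fun_prop)).continuousWithinAt

/-- A nonvanishing function on a family, parametrized by the plane, of nonempty open sets with
simply connected slices has a continuous logarithm on the total space. -/
theorem exists_log_of_fibers {Z : Type*} [NormedAddCommGroup Z] [NormedSpace ℂ Z]
    {X : Set (ℂ × Z)} (hX : IsOpen X) (hne : ∀ y, {z | (y, z) ∈ X}.Nonempty)
    (hsl : ∀ y, HasSimplyConnectedSlices {z | (y, z) ∈ X}) {g : ℂ × Z → ℂ}
    (hg : ContinuousOn g X) (hg0 : ∀ p ∈ X, g p ≠ 0) :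
    ∃ L : ℂ × Z → ℂ, ContinuousOn L X ∧ ∀ p ∈ X, Complex.exp (L p) = g p := by
  have hfib : ∀ y, ∃ M : Z → ℂ, ContinuousOn M {z | (y, z) ∈ X} ∧
      ∀ z ∈ {z | (y, z) ∈ X}, Complex.exp (M z) = g (y, z) := fun y =>
    (hsl y).exists_log (hX.preimage (by fun_prop)) (hg.comp (by fun_prop) fun z hz => hz)
      fun z hz => hg0 _ hz
  choose M hM hMe using hfib
  choose ζ hζ using hne
  have hloc : ∀ i : ℂ, ∃ U : Set ℂ, IsOpen U ∧ i ∈ U ∧ (∀ y ∈ U, (y, ζ i) ∈ X) ∧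
      ∃ ψ : ℂ → ℂ, ContinuousOn ψ U ∧ ∀ y ∈ U, Complex.exp (ψ y) = g (y, ζ i) := by
    intro i
    obtain ⟨U, hUX, hU, hi, ψ, hψ⟩ := exists_local_log (X := {y | (y, ζ i) ∈ X})
      (g := fun y => g (y, ζ i)) (hX.preimage (by fun_prop))
      (hg.comp (by fun_prop) fun y hy => hy) (fun y hy => hg0 _ hy) (hζ i)
    exact ⟨U, hU, hi, hUX, ψ, hψ⟩
  choose U hU hiU hUX ψ hψ hψe using hloc
  obtain ⟨φ, hφ⟩ := PartitionOfUnity.exists_isSubordinate isClosed_univ U hU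
    fun y _ => mem_iUnion.2 ⟨y, hiU y⟩
  let κ : ℂ → ℂ → ℂ := fun i y => ψ i y - M y (ζ i)
  have hκe : ∀ i, ∀ y ∈ U i, Complex.exp (κ i y) = 1 := by
    intro i y hy
    simp only [κ]
    rw [Complex.exp_sub, hψe i y hy, hMe y _ (hUX i y hy), div_self (hg0 _ (hUX i y hy))]
  have hκc : ∀ i, ∀ y ∈ U i, ∀ z, (y, z) ∈ X →
      ContinuousAt (fun p : ℂ × Z => M p.1 p.2 + κ i p.1) (y, z) := by
    intro i y hy z hz
    refine continuousAt_of_fiberwise_log hX hg hg0 (z₀ := ζ i)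
      (Eventually.of_forall fun v => (hM v).add (continuousOn_const (c := κ i v))) ?_
      (hsl y).isPreconnected (hUX i y hy) ?_ hz
    · filter_upwards [(hU i).mem_nhds hy] with v hv z hz
      rw [Complex.exp_add, hκe i v hv, mul_one, hMe v z hz]
    · simpa [κ] using (hψ i).continuousAt ((hU i).mem_nhds hy)
  let K : ℂ → ℂ := fun y => ∑ᶠ i, φ i y • κ i y
  have hMK : ∀ p ∈ X, ContinuousAt (fun p : ℂ × Z => M p.1 p.2 + K p.1) p := by
    rintro ⟨y, z⟩ hp
    obtain ⟨I, n, hn, hnU, hsupp⟩ := φ.exists_finset_nhds_support_subset hφ hU y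
    have hyU : ∀ i ∈ I, y ∈ U i := fun i hi => mem_iInter₂.1 (hnU (mem_of_mem_nhds hn)) i hi
    have hsum : ContinuousAt (fun p : ℂ × Z => ∑ i ∈ I, φ i p.1 • (M p.1 p.2 + κ i p.1))
        (y, z) := by
      refine tendsto_finsetSum _ fun i hi => ?_
      exact ContinuousAt.smul (((φ i).continuous.comp continuous_fst).continuousAt)
        (hκc i y (hyU i hi) z hp)
    refine hsum.congr ?_
    filter_upwards [continuous_fst.continuousAt.preimage_mem_nhds hn] with p hpn
    have h1 : ∑ i ∈ I, φ i p.1 = 1 := by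
      rw [← finsum_eq_sum_of_support_subset _ (hsupp p.1 hpn)]
      exact φ.sum_eq_one (mem_univ _)
    have h2 : K p.1 = ∑ i ∈ I, φ i p.1 • κ i p.1 :=
      finsum_eq_sum_of_support_subset _
        ((Function.support_smul_subset_left _ _).trans (hsupp p.1 hpn))
    simp only [smul_add, Finset.sum_add_distrib]
    rw [h2, ← Finset.sum_smul, h1, one_smul]
  have hKc : Continuous fun y => Complex.exp (K y) := by
    rw [continuous_iff_continuousAt]
    intro y
    have h1 : ContinuousAt (fun v => Complex.exp (M v (ζ y) + K v) / g (v, ζ y)) y := by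
      refine ContinuousAt.div ?_ ?_ (hg0 _ (hζ y))
      · exact ((hMK _ (hζ y)).comp (f := fun v => (v, ζ y)) (by fun_prop)).cexp
      · exact (hg.continuousAt (hX.mem_nhds (hζ y))).comp (f := fun v => (v, ζ y)) (by fun_prop)
    refine h1.congr ?_
    filter_upwards [(hU y).mem_nhds (hiU y)] with v hv
    have hv' := hUX y v hv
    rw [Complex.exp_add, hMe v _ hv', mul_div_cancel_left₀ _ (hg0 _ hv')]
  obtain ⟨η, hη, hηe⟩ := Complex.exists_continuousOn_eqOn_exp_comp
    isSimplyConnected_univ_complex isOpen_univ hKc.continuousOn (by simp)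
  refine ⟨fun p => M p.1 p.2 + K p.1 - η p.1, fun p hp => ?_, fun p hp => ?_⟩
  · exact ((hMK p hp).sub ((continuousOn_univ.1 hη).comp continuous_fst).continuousAt)
      |>.continuousWithinAt
  · have h1 : Complex.exp (η p.1) = Complex.exp (K p.1) := hηe (mem_univ p.1)
    rw [Complex.exp_sub, Complex.exp_add, h1, mul_div_cancel_right₀ _ (Complex.exp_ne_zero _)]
    exact hMe p.1 p.2 hp

theorem not_continuousOn_circle_log {θ : ℂ → ℂ} {μ : ℂ} (hμ : μ ≠ 0)
    (hθ : ContinuousOn θ (Metric.sphere 0 1))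
    (he : ∀ w ∈ Metric.sphere (0 : ℂ) 1, Complex.exp (θ w) = μ / w) : False := by
  have hmem : ∀ t : ℝ, Complex.exp (t * Complex.I) ∈ Metric.sphere (0 : ℂ) 1 := fun t => by
    simp [Complex.norm_exp_ofReal_mul_I]
  have hc : Continuous fun t : ℝ => θ (Complex.exp (t * Complex.I)) + t * Complex.I :=
    (hθ.comp_continuous (by fun_prop) hmem).add (by fun_prop)
  have h := isPreconnected_univ.sub_eq_sub_of_exp_eq hc.continuousOn
    (continuousOn_const (c := Complex.log μ)) (fun t _ => by
      rw [Complex.exp_add, he _ (hmem t), div_mul_cancel₀ _ (Complex.exp_ne_zero _),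
        Complex.exp_log hμ]) (mem_univ 0) (mem_univ (2 * Real.pi))
  simp [Complex.exp_two_pi_mul_I, Real.pi_ne_zero] at h

theorem exists_line_disjoint {V : Type*} [NormedAddCommGroup V] [NormedSpace ℂ V]
    {D : Set V} (hDo : IsOpen D) (hD : HasSimplyConnectedSlices D) (W : Submodule ℂ V) (q : V)
    (hW : ∀ u ∈ W, q + u ∉ D) (e₁ e₂ : V) :
    ∃ a b : ℂ, (a ≠ 0 ∨ b ≠ 0) ∧ ∀ c : ℂ, ∀ u ∈ W, q + (c • (a • e₁ + b • e₂) + u) ∉ D := by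
  by_contra! hcon
  let ν : ℂ → V := fun w => w • e₁ + ((max 0 (1 - ‖w‖) : ℝ) : ℂ) • e₂
  have hν : Continuous ν := by fun_prop
  let X : Set (ℂ × (ℂ × W)) := {p | q + (p.2.1 • ν p.1 + p.2.2) ∈ D}
  have hXo : IsOpen X := hDo.preimage (by fun_prop)
  have hne : ∀ w, {z | (w, z) ∈ X}.Nonempty := by
    intro w
    obtain ⟨c, u, hu, h⟩ := hcon w ((max 0 (1 - ‖w‖) : ℝ) : ℂ) (by
      by_contra! h
      simp [h.1] at h)
    exact ⟨(c, ⟨u, hu⟩), h⟩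
  have hsl : ∀ w, HasSimplyConnectedSlices {z | (w, z) ∈ X} := fun w =>
    hD.preimage ((LinearMap.toSpanSingleton ℂ V (ν w)).coprod W.subtype) q
  have hg0 : ∀ p ∈ X, p.2.1 ≠ 0 := by
    intro p hp h
    refine hW p.2.2 p.2.2.2 ?_
    simpa [X, h] using hp
  obtain ⟨L, hL, hLe⟩ := exists_log_of_fibers hXo hne hsl (g := fun p => p.2.1) (by fun_prop) hg0
  obtain ⟨⟨μ, u⟩, hμ⟩ := hne 1
  have hmem : ∀ w ∈ Metric.sphere (0 : ℂ) 1, (w, (μ / w, u)) ∈ X := by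
    intro w hw
    have hw1 : ‖w‖ = 1 := by simpa using hw
    have hw0 : w ≠ 0 := by
      rintro rfl
      simp at hw1
    simpa [X, ν, hw1, smul_smul, div_mul_cancel₀ _ hw0] using hμ
  refine not_continuousOn_circle_log (hg0 _ hμ) (θ := fun w => L (w, (μ / w, u)))
    (hL.comp ?_ hmem) fun w hw => hLe _ (hmem w hw)
  refine continuousOn_id.prodMk (ContinuousOn.prodMk (continuousOn_const.div continuousOn_id ?_)
    continuousOn_const)
  rintro w hw rfl
  simp at hw

/-- An affine subspace missing an open `ℂ`-convex set extends to a hyperplane missing it. -/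
theorem exists_hyperplane_disjoint {V : Type*} [NormedAddCommGroup V] [NormedSpace ℂ V]
    [FiniteDimensional ℂ V] {D : Set V} (hDo : IsOpen D) (hD : HasSimplyConnectedSlices D)
    (hDne : D.Nonempty) (W : Submodule ℂ V) (q : V) (hW : ∀ u ∈ W, q + u ∉ D) :
    ∃ f : V →L[ℂ] ℂ, f ≠ 0 ∧ (∀ u ∈ W, f u = 0) ∧ ∀ x ∈ D, f x ≠ f q := by
  obtain ⟨W', ⟨hWW', hW'⟩, hmax⟩ := wellFounded_gt.has_min
    {W' : Submodule ℂ V | W ≤ W' ∧ ∀ u ∈ W', q + u ∉ D} ⟨W, le_rfl, hW⟩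
  obtain ⟨x₀, hx₀⟩ := hDne
  have he₁ : x₀ - q ∉ W' := fun h => hW' _ h (by simpa using hx₀)
  have htop : W' ⊔ ℂ ∙ (x₀ - q) = ⊤ := by
    by_contra hne
    obtain ⟨e₂, he₂⟩ : ∃ e₂, e₂ ∉ W' ⊔ ℂ ∙ (x₀ - q) := by
      by_contra! h
      exact hne (Submodule.eq_top_iff'.2 h)
    obtain ⟨a, b, hab, hmiss⟩ := exists_line_disjoint hDo hD W' q hW' (x₀ - q) e₂
    have hle : W' ⊔ ℂ ∙ (a • (x₀ - q) + b • e₂) ≤ W' := by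
      refine (le_sup_left.lt_or_eq.resolve_left
        (hmax _ ⟨hWW'.trans le_sup_left, fun u hu => ?_⟩)).ge
      obtain ⟨u', hu', y, hy, rfl⟩ := Submodule.mem_sup.1 hu
      obtain ⟨c, rfl⟩ := Submodule.mem_span_singleton.1 hy
      rw [add_comm u']
      exact hmiss c u' hu'
    have hv : a • (x₀ - q) + b • e₂ ∈ W' :=
      hle (Submodule.mem_sup_right (Submodule.mem_span_singleton_self _))
    have hb : b = 0 := by
      by_contra hb
      apply he₂
      have h1 : b • e₂ ∈ W' ⊔ ℂ ∙ (x₀ - q) := by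
        have := Submodule.sub_mem _ (Submodule.mem_sup_left (T := ℂ ∙ (x₀ - q)) hv)
          (Submodule.smul_mem _ a (Submodule.mem_sup_right (S := W')
            (Submodule.mem_span_singleton_self (x₀ - q))))
        simpa using this
      exact (Submodule.smul_mem_iff _ hb).1 h1
    have ha : a ≠ 0 := by
      rcases hab with h | h
      · exact h
      · exact absurd hb h
    apply he₁
    rw [hb, zero_smul, add_zero] at hv
    exact (Submodule.smul_mem_iff _ ha).1 hv
  obtain ⟨f, hf0, hf⟩ := Submodule.exists_le_ker_of_lt_top W'
    (lt_top_iff_ne_top.2 fun h => he₁ (h ▸ Submodule.mem_top))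
  have hfe : f (x₀ - q) ≠ 0 := by
    intro h
    apply hf0
    rw [← LinearMap.ker_eq_top, eq_top_iff, ← htop]
    exact sup_le hf ((Submodule.span_singleton_le_iff_mem _ _).2 h)
  refine ⟨LinearMap.toContinuousLinearMap f, by simpa using hf0, fun u hu => hf (hWW' hu), ?_⟩
  intro x hx hxq
  have hxt : x - q ∈ W' ⊔ ℂ ∙ (x₀ - q) := htop ▸ Submodule.mem_top
  obtain ⟨u, hu, y, hy, huy⟩ := Submodule.mem_sup.1 hxt
  obtain ⟨c, rfl⟩ := Submodule.mem_span_singleton.1 hy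
  have h1 : f (x - q) = 0 := by
    have : f x = f q := hxq
    rw [map_sub, this, sub_self]
  have h2 : f u = 0 := hf hu
  rw [← huy, map_add, h2, zero_add, map_smul, smul_eq_mul, mul_eq_zero] at h1
  have hc : c = 0 := h1.resolve_right hfe
  refine hW' u hu ?_
  have : u = x - q := by simpa [hc] using huy
  simpa [this] using hx

/-- Two points of the closure of a set with simply connected complex-line slices, both lying in the
same fibre of a linear map, coincide as soon as the first is isolated in the part of the closure
lying in that fibre. -/
theorem eq_of_isolated_in_fiber {V V' : Type*} [NormedAddCommGroup V] [NormedSpace ℂ V]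
    [NormedAddCommGroup V'] [NormedSpace ℂ V'] {D : Set V} (hD : HasSimplyConnectedSlices D)
    (π : V →L[ℂ] V') {q₁ q₂ : V} (h₁ : q₁ ∈ closure D) (h₂ : q₂ ∈ closure D)
    (hπ : π q₁ = π q₂) {U : Set V} (hU : U ∈ 𝓝 q₁)
    (hiso : ∀ z ∈ U, z ∈ closure D → π z = π q₁ → z = q₁) : q₁ = q₂ := by
  by_contra hne
  have hd : 0 < dist q₁ q₂ := dist_pos.2 hne
  obtain ⟨ε, hε, hεU⟩ := Metric.nhds_basis_closedBall.mem_iff.1 hU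
  let r := min ε (dist q₁ q₂ / 2)
  have hr : 0 < r := lt_min hε (by positivity)
  have hrd : r ≤ dist q₁ q₂ / 2 := min_le_right _ _
  obtain ⟨x₁, hx₁D, hx₁⟩ := mem_closure_iff_seq_limit.1 h₁
  obtain ⟨x₂, hx₂D, hx₂⟩ := mem_closure_iff_seq_limit.1 h₂
  have hdiff : Tendsto (fun n => x₂ n - x₁ n) atTop (𝓝 (q₂ - q₁)) := hx₂.sub hx₁
  have hev : ∀ᶠ n in atTop, dist (x₁ n) q₁ < r ∧ r < dist (x₂ n) q₁ ∧
      dist q₁ q₂ / 2 < ‖x₂ n - x₁ n‖ := by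
    have e₁ : Tendsto (fun n => dist (x₁ n) q₁) atTop (𝓝 0) := tendsto_iff_dist_tendsto_zero.1 hx₁
    have e₂ : Tendsto (fun n => dist (x₂ n) q₁) atTop (𝓝 (dist q₂ q₁)) :=
      hx₂.dist tendsto_const_nhds
    have e₃ := hdiff.norm
    rw [← dist_eq_norm, dist_comm] at e₃
    rw [dist_comm] at e₂
    filter_upwards [e₁.eventually_lt_const hr, e₂.eventually_const_lt (by linarith : r < _),
      e₃.eventually_const_lt (half_lt_self hd)] with n a b c using ⟨a, b, c⟩
  obtain ⟨N, hN⟩ := eventually_atTop.1 hev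
  have hcross : ∀ n, ∃ s : ℂ, N ≤ n → x₁ n + s • (x₂ n - x₁ n) ∈ D ∧
      dist (x₁ n + s • (x₂ n - x₁ n)) q₁ = r := by
    intro n
    by_cases hn : N ≤ n
    swap
    · exact ⟨0, fun h => absurd h hn⟩
    have m0 : (0 : ℂ) ∈ {s : ℂ | x₁ n + s • (x₂ n - x₁ n) ∈ D} := by simpa using hx₁D n
    have m1 : (1 : ℂ) ∈ {s : ℂ | x₁ n + s • (x₂ n - x₁ n) ∈ D} := by simpa using hx₂D n
    obtain ⟨s, hs, hsr⟩ := (hD (x₁ n) (x₂ n - x₁ n) ⟨0, m0⟩).isPathConnected.isConnected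
      |>.isPreconnected.intermediate_value m0 m1
      (f := fun s : ℂ => dist (x₁ n + s • (x₂ n - x₁ n)) q₁) (by fun_prop)
      (show r ∈ _ from ⟨by simpa using (hN n hn).1.le, by simpa using (hN n hn).2.1.le⟩)
    exact ⟨s, fun _ => ⟨hs, hsr⟩⟩
  choose s hs using hcross
  have hbdd : ∀ n, s (n + N) ∈ Metric.closedBall (0 : ℂ) (2 * r / (dist q₁ q₂ / 2)) := by
    intro n
    have hn : N ≤ n + N := Nat.le_add_left _ _
    obtain ⟨-, hdist⟩ := hs _ hn
    obtain ⟨a, -, c⟩ := hN _ hn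
    rw [mem_closedBall_zero_iff, le_div_iff₀ (by positivity)]
    have h3 : ‖s (n + N)‖ * ‖x₂ (n + N) - x₁ (n + N)‖ ≤ 2 * r := by
      rw [← norm_smul]
      calc ‖s (n + N) • (x₂ (n + N) - x₁ (n + N))‖
          = dist (x₁ (n + N) + s (n + N) • (x₂ (n + N) - x₁ (n + N))) (x₁ (n + N)) := by
            rw [dist_eq_norm, add_sub_cancel_left]
        _ ≤ _ + dist (x₁ (n + N)) q₁ := dist_triangle_right _ _ q₁
        _ ≤ 2 * r := by linarith
    exact (mul_le_mul_of_nonneg_left c.le (norm_nonneg _)).trans h3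
  obtain ⟨t, -, φ, hφ, ht⟩ := (isCompact_closedBall (0 : ℂ) _).tendsto_subseq hbdd
  have hψ : Tendsto (fun n => φ n + N) atTop atTop :=
    (tendsto_add_atTop_nat N).comp hφ.tendsto_atTop
  have hlim : Tendsto (fun n => x₁ (φ n + N) + s (φ n + N) • (x₂ (φ n + N) - x₁ (φ n + N)))
      atTop (𝓝 (q₁ + t • (q₂ - q₁))) :=
    (hx₁.comp hψ).add (ht.smul (hdiff.comp hψ))
  have hmem : q₁ + t • (q₂ - q₁) ∈ closure D :=
    mem_closure_of_tendsto hlim (Eventually.of_forall fun n => (hs _ (Nat.le_add_left _ _)).1)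
  have hdist : dist (q₁ + t • (q₂ - q₁)) q₁ = r :=
    tendsto_nhds_unique (hlim.dist tendsto_const_nhds)
      (tendsto_const_nhds.congr fun n => (hs _ (Nat.le_add_left _ _)).2.symm)
  have heq := hiso _ (hεU (by
    rw [Metric.mem_closedBall, hdist]
    exact min_le_left _ _)) hmem (by simp [hπ])
  rw [heq, dist_self] at hdist
  exact hr.ne hdist

/-- Strong normality passes to the image under an open map when the fibre over the boundary
point meets the compact closure in a single point. -/
theorem StronglyNormalAt.image_of_subsingleton_fiber {V V' : Type*} [NormedAddCommGroup V]
    [NormedAddCommGroup V'] {D : Set V} {π : V → V'}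
    (hπ : Continuous π) (hopen : IsOpenMap π) (hDo : IsOpen D) (hc : IsCompact (closure D))
    {q : V} (hq : StronglyNormalAt D q) (huniq : ∀ z ∈ closure D, π z = π q → z = q) :
    StronglyNormalAt (π '' D) (π q) := by
  intro U hU hpU
  obtain ⟨V₀, hV₀, hqV₀, hV₀U, hconn⟩ := hq (π ⁻¹' U) (hU.preimage hπ) hpU
  have hK : IsClosed (π '' (closure D \ V₀)) := ((hc.diff hV₀).image hπ).isClosed
  have hpK : π q ∉ π '' (closure D \ V₀) := by
    rintro ⟨z, hz, hzq⟩
    exact hz.2 (huniq z hz.1 hzq ▸ hqV₀)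
  refine ⟨(U \ π '' (closure D \ V₀)) ∪ π '' (V₀ ∩ D),
    (hU.sdiff hK).union (hopen _ (hV₀.inter hDo)), Or.inl ⟨hpU, hpK⟩,
    union_subset sdiff_subset ?_, ?_⟩
  · rintro _ ⟨z, hz, rfl⟩
    exact hV₀U hz.1
  · convert hconn.image π hπ.continuousOn using 1
    apply Subset.antisymm
    · rintro x ⟨hx | hx, d, hd, rfl⟩
      · refine ⟨d, ⟨?_, hd⟩, rfl⟩
        by_contra h
        exact hx.2 ⟨d, ⟨subset_closure hd, h⟩, rfl⟩
      · exact hx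
    · intro x hx
      exact ⟨Or.inr hx, image_mono inter_subset_right hx⟩

/-- Let `D` be a bounded ℂ-convex domain in `ℂ^{n+m} = ℂⁿ × ℂᵐ` that is strictly ℂ-convex
and strongly normal, and let `π = Prod.fst` be the projection onto the first `n`
coordinates. Then the shadow `π(D)` is a strongly normal domain in ℂⁿ. -/
theorem shadow_stronglyNormal {n m : ℕ}
    (D : Set (EuclideanSpace ℂ (Fin n) × EuclideanSpace ℂ (Fin m)))
    (hOpen : IsOpen D) (hConn : IsConnected D) (hBdd : Bornology.IsBounded D)
    (hCC : IsCConvex D)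
    (hStrict : ∀ q ∈ frontier D, StrictlyCConvexAt D q)
    (hNormal : ∀ q ∈ frontier D, StronglyNormalAt D q) :
    (IsOpen (Prod.fst '' D) ∧ IsConnected (Prod.fst '' D) ∧
      Bornology.IsBounded (Prod.fst '' D)) ∧
    ∀ p ∈ frontier (Prod.fst '' D), StronglyNormalAt (Prod.fst '' D) p := by
  have hopen : IsOpenMap (Prod.fst : EuclideanSpace ℂ (Fin n) × EuclideanSpace ℂ (Fin m) → _) :=
    isOpenMap_fst
  have hc : IsCompact (closure D) := hBdd.isCompact_closure
  refine ⟨⟨hopen D hOpen, hConn.image _ continuous_fst.continuousOn,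
    (hc.image continuous_fst).isBounded.subset (image_mono subset_closure)⟩, fun p hp => ?_⟩
  have hpD : p ∉ Prod.fst '' D := fun h => by
    rw [(hopen D hOpen).frontier_eq] at hp
    exact hp.2 h
  obtain ⟨q, hq, rfl⟩ : p ∈ Prod.fst '' closure D :=
    closure_minimal (image_mono subset_closure) (hc.image continuous_fst).isClosed
      (frontier_subset_closure hp)
  have hqD : q ∉ D := fun h => hpD ⟨q, h, rfl⟩
  have hqf : q ∈ frontier D := by
    rw [hOpen.frontier_eq]
    exact ⟨hq, hqD⟩
  let π := ContinuousLinearMap.fst ℂ (EuclideanSpace ℂ (Fin n)) (EuclideanSpace ℂ (Fin m))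
  have hD := hCC.hasSimplyConnectedSlices
  obtain ⟨f, hf0, hfW, hfD⟩ := exists_hyperplane_disjoint hOpen hD hConn.nonempty
    (LinearMap.ker π.toLinearMap) q fun u hu h => hpD ⟨q + u, h, by
      have : u.1 = 0 := hu
      simp [this]⟩
  obtain ⟨U, hU, hqU, hstrict⟩ := hStrict q hqf
  have hpt := hstrict {x | f x = f q} ⟨f, f q, hf0, rfl⟩ rfl
    (eq_empty_of_forall_notMem fun x hx => hfD x hx.2 hx.1)
  refine (hNormal q hqf).image_of_subsingleton_fiber continuous_fst hopen hOpen hc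
    fun z hz hzq => (eq_of_isolated_in_fiber hD π hq hz hzq.symm (hU.mem_nhds hqU) ?_).symm
  intro y hyU hy hyq
  have hker : y - q ∈ LinearMap.ker π.toLinearMap := by
    change π (y - q) = 0
    rw [map_sub, hyq, sub_self]
  have hfy : f y = f q := by
    have := hfW _ hker
    rwa [map_sub, sub_eq_zero] at this
  exact hpt.subset ⟨⟨hyU, hy⟩, hfy⟩
end

section
/- Let D be a bounded ℂ-convex domain in ℂⁿ that is strictly ℂ-convex and normal. Then every boundary point p ∈ ∂D is an A(D)-peak point. -/
open Set Topology Filter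

/-- A continuous function whose exponential is constant on a preconnected set is constant there. -/
theorem IsPreconnected.eq_of_exp_eq {X : Type*} [TopologicalSpace X] {s : Set X}
    (hs : IsPreconnected s) {θ : X → ℂ} (hθ : ContinuousOn θ s)
    (he : ∀ x ∈ s, ∀ y ∈ s, Complex.exp (θ x) = Complex.exp (θ y)) {x y : X}
    (hx : x ∈ s) (hy : y ∈ s) : θ x = θ y :=
  Complex.isCoveringMap_exp.isSeparatedMap.constOn_of_comp
    Complex.isCoveringMap_exp.isLocalHomeomorph.isLocallyInjective hs hθ
    (fun a ha b hb => Subtype.ext (he a ha b hb)) hx hy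

section CConvex

variable {E : Type*} [NormedAddCommGroup E] [NormedSpace ℂ E] {D : Set E}

theorem IsCConvex.isSimplyConnected_slice (hCC : IsCConvex D) {b : E} (hb : b ∈ D) (v : E) :
    IsSimplyConnected {t : ℂ | b + t • v ∈ D} := by
  rcases eq_or_ne v 0 with rfl | hv
  · have : {t : ℂ | b + t • (0 : E) ∈ D} = univ := by ext; simp [hb]
    rw [this]
    exact (Homeomorph.Set.univ ℂ).toHomotopyEquiv.simplyConnectedSpace
  · have hemb : IsEmbedding fun t : ℂ => b + t • v :=
      (Homeomorph.addLeft b).isEmbedding.comp (isClosedEmbedding_smul_left hv).isEmbedding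
    rw [← hemb.isSimplyConnected_image]
    have himg : (fun t : ℂ => b + t • v) '' {t : ℂ | b + t • v ∈ D} =
        {x | ∃ t : ℂ, x = b + t • v} ∩ D := by
      ext x
      constructor
      · rintro ⟨t, ht, rfl⟩
        exact ⟨⟨t, rfl⟩, ht⟩
      · rintro ⟨⟨t, rfl⟩, ht⟩
        exact ⟨t, ht, rfl⟩
    rw [himg]
    exact (hCC _ ⟨b, v, hv, rfl⟩ ⟨b, ⟨0, by simp⟩, hb⟩).2

/-- A continuous choice of logarithms of an affine function `φ + c` at base points `b x` of a
ℂ-convex open set propagates to `e x` along the complex lines joining `b x` to `e x`. -/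
theorem IsCConvex.exists_continuous_log (hCC : IsCConvex D) (hD : IsOpen D)
    (φ : E →L[ℂ] ℂ) (c : ℂ) {X : Type*} [TopologicalSpace X] {b e : X → E} {l : X → ℂ}
    (hb : Continuous b) (he : Continuous e) (hl : Continuous l)
    (hbD : ∀ x, b x ∈ D) (heD : ∀ x, e x ∈ D) (hexp : ∀ x, Complex.exp (l x) = φ (b x) + c)
    (hne : ∀ x, ∀ t : ℂ, b x + t • (e x - b x) ∈ D → φ (b x + t • (e x - b x)) + c ≠ 0) :
    ∃ L : X → ℂ, Continuous L ∧ ∀ x, Complex.exp (L x) = φ (e x) + c := by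
  have key : ∀ x, ∃ h : ℂ → ℂ, ContinuousOn h {t : ℂ | b x + t • (e x - b x) ∈ D} ∧
      (∀ t : ℂ, b x + t • (e x - b x) ∈ D →
        Complex.exp (h t) = φ (b x + t • (e x - b x)) + c) ∧ h 0 = l x := by
    intro x
    have h0 : (0 : ℂ) ∈ {t : ℂ | b x + t • (e x - b x) ∈ D} := by simp [hbD x]
    obtain ⟨h, hc, hh⟩ := Complex.exists_continuousOn_eqOn_exp_comp
      (hCC.isSimplyConnected_slice (hbD x) (e x - b x)) (hD.preimage (by fun_prop))
      (g := fun t => φ (b x + t • (e x - b x)) + c) (by fun_prop)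
      (by rintro ⟨t, ht, h⟩; exact hne x t ht h)
    refine ⟨fun t => h t - h 0 + l x, by fun_prop, fun t ht => ?_, by simp⟩
    have h1 := hh ht
    have h2 := hh h0
    simp only [Function.comp_apply, zero_smul, add_zero] at h1 h2
    rw [Complex.exp_add, Complex.exp_sub, h1, h2, hexp, div_mul_cancel₀]
    simpa using hne x 0 h0
  choose h hc hh h0 using key
  have one_mem : ∀ x, (1 : ℂ) ∈ {t : ℂ | b x + t • (e x - b x) ∈ D} := fun x => by simp [heD x]
  refine ⟨fun x => h x 1, continuous_iff_continuousAt.2 fun x₁ => ?_, fun x => by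
    simpa using hh x 1 (one_mem x)⟩
  obtain ⟨γ, hγ⟩ := (hCC.isSimplyConnected_slice (hbD x₁) (e x₁ - b x₁)).isPathConnected.joinedIn 0
    (by simp [hbD x₁]) 1 (one_mem x₁)
  set G : X → unitInterval → ℂ := fun x s => φ (b x + γ s • (e x - b x)) + c with hG
  have hG₁ : ∀ s, G x₁ s ≠ 0 := fun s => hne x₁ _ (hγ s)
  have hGc : Continuous fun y : X × unitInterval => G y.1 y.2 := by
    simp only [hG]; fun_prop
  have htube : ∀ᶠ x in 𝓝 x₁, ∀ s ∈ (univ : Set unitInterval),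
      b x + γ s • (e x - b x) ∈ D ∧ G x s / G x₁ s ∈ Complex.slitPlane := by
    refine isCompact_univ.eventually_forall_of_forall_eventually fun s _ => ?_
    have c1 : Continuous fun y : X × unitInterval => b y.1 + γ y.2 • (e y.1 - b y.1) := by fun_prop
    have c2 : Continuous fun y : X × unitInterval => G y.1 y.2 / G x₁ y.2 := by
      refine hGc.div ?_ fun y => hG₁ _
      exact hGc.comp (by fun_prop : Continuous fun y : X × unitInterval => (x₁, y.2))
    have hs : b x₁ + γ s • (e x₁ - b x₁) ∈ D := hγ s
    refine (c1.continuousAt.eventually (hD.mem_nhds hs)).and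
      (c2.continuousAt.eventually (Complex.isOpen_slitPlane.mem_nhds ?_))
    simp [div_self (hG₁ s)]
  have heq : ∀ᶠ x in 𝓝 x₁, h x₁ 1 + Complex.log (G x 1 / G x₁ 1) +
      (l x - l x₁ - Complex.log (G x 0 / G x₁ 0)) = h x 1 := by
    filter_upwards [htube] with x hx
    have hx1 := fun s => (hx s (mem_univ s)).1
    have hx2 := fun s => (hx s (mem_univ s)).2
    have hcont : Continuous fun s : unitInterval =>
        h x (γ s) - h x₁ (γ s) - Complex.log (G x s / G x₁ s) := by
      refine (((hc x).comp_continuous γ.continuous hx1).sub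
        ((hc x₁).comp_continuous γ.continuous hγ)).sub (Continuous.clog ?_ hx2)
      refine Continuous.div ?_ ?_ hG₁ <;> simp only [hG] <;> fun_prop
    have hexp1 : ∀ s, Complex.exp (h x (γ s) - h x₁ (γ s) - Complex.log (G x s / G x₁ s)) = 1 := by
      intro s
      have : G x s / G x₁ s ≠ 0 := Complex.slitPlane_ne_zero (hx2 s)
      rw [Complex.exp_sub, Complex.exp_sub, hh x _ (hx1 s), hh x₁ _ (hγ s), Complex.exp_log this]
      exact div_self this
    have := isPreconnected_univ.eq_of_exp_eq hcont.continuousOn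
      (fun s _ t _ => (hexp1 s).trans (hexp1 t).symm) (mem_univ 0) (mem_univ 1)
    simp only [γ.source, γ.target, h0] at this
    linear_combination this
  have hlog : ∀ s, ContinuousAt (fun x => Complex.log (G x s / G x₁ s)) x₁ := by
    intro s
    refine ContinuousAt.clog ?_ (by simp [div_self (hG₁ s)])
    refine (Continuous.div_const ?_ _).continuousAt
    simp only [hG]; fun_prop
  refine ContinuousAt.congr ?_ heq
  exact (continuousAt_const.add (hlog 1)).add
    ((hl.continuousAt.sub continuousAt_const).sub (hlog 0))

/-- An affine function without zeros on a ℂ-convex open set has a holomorphic logarithm. -/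
theorem IsCConvex.exists_log (hCC : IsCConvex D) (hD : IsOpen D) (φ : E →L[ℂ] ℂ) (c : ℂ)
    (hne : ∀ x ∈ D, φ x + c ≠ 0) :
    ∃ L : E → ℂ, DifferentiableOn ℂ L D ∧ ∀ x ∈ D, Complex.exp (L x) = φ x + c := by
  rcases D.eq_empty_or_nonempty with rfl | ⟨x₀, hx₀⟩
  · exact ⟨0, by simp, by simp⟩
  obtain ⟨L, hLc, hL⟩ := hCC.exists_continuous_log hD φ c (X := D) (b := fun _ => x₀)
    (e := fun x => x) (l := fun _ => Complex.log (φ x₀ + c)) (by fun_prop) (by fun_prop)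
    (by fun_prop) (fun _ => hx₀) (fun x => x.2) (fun _ => Complex.exp_log (hne x₀ hx₀))
    (fun x t ht => hne _ ht)
  classical
  let M : E → ℂ := fun x => if hx : x ∈ D then L ⟨x, hx⟩ else 0
  have hM : ∀ x ∈ D, Complex.exp (M x) = φ x + c := fun x hx => by simp [M, hx, hL]
  have hMc : ContinuousOn M D := by
    rw [continuousOn_iff_continuous_domRestrict]
    convert hLc using 1
    ext x
    simp [M]
  refine ⟨M, fun x hx => ?_, hM⟩
  have hev : ∀ᶠ y in 𝓝 x, M y = M x + Complex.log ((φ y + c) / (φ x + c)) := by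
    have h1 : ContinuousAt (fun y => (M y - M x).im) x := by
      have := hMc.continuousAt (hD.mem_nhds hx)
      fun_prop
    have h2 : ∀ᶠ y in 𝓝 x, (M y - M x).im ∈ Ioo (-Real.pi) Real.pi :=
      h1.eventually (Ioo_mem_nhds (by simp [Real.pi_pos]) (by simp [Real.pi_pos]))
    filter_upwards [h2, hD.mem_nhds hx] with y hy hyD
    rw [← hM y hyD, ← hM x hx, ← Complex.exp_sub, Complex.log_exp hy.1 hy.2.le]
    ring
  have hdiff : DifferentiableAt ℂ (fun y => M x + Complex.log ((φ y + c) / (φ x + c))) x := by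
    refine (DifferentiableAt.clog (by fun_prop) ?_).const_add _
    simp [div_self (hne x hx)]
  exact (hdiff.congr_of_eventuallyEq hev).differentiableWithinAt

end CConvex

section Hyperplane

variable {E : Type*} [NormedAddCommGroup E] [InnerProductSpace ℂ E] {D : Set E}

/-- If a ball centred at `u` in a ℂ-convex open set `D` has a point `p ∉ D` on its bounding sphere,
then `D` does not meet the complex tangent hyperplane to that sphere at `p`. -/
theorem IsCConvex.inner_ne_zero_of_ball_subset (hCC : IsCConvex D) (hD : IsOpen D) {u p q : E}
    (hu : u ∈ D) (hball : Metric.ball u ‖u - p‖ ⊆ D) (hp : p ∉ D) (hq : q ∈ D) :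
    inner ℂ (u - p) (q - p) ≠ 0 := by
  intro h0
  set a := u - p with ha
  have ha0 : a ≠ 0 := sub_ne_zero.2 fun h => hp (h ▸ hu)
  have ha0' : 0 < ‖a‖ := norm_pos_iff.2 ha0
  obtain ⟨δ, hδ, hδD⟩ := Metric.isOpen_iff.1 hD q hq
  set ε : ℝ := δ / (2 * ‖a‖) with hε
  have hε0 : 0 < ε := by positivity
  let w : Circle → E := fun θ => (q - p) + ((ε : ℂ) * θ) • a
  have hwc : Continuous w := by fun_prop
  let g : Circle → ℂ := fun θ => inner ℂ a (w θ)
  have hgc : Continuous g := by fun_prop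
  have hg : ∀ θ, g θ = (ε : ℂ) * θ * (‖a‖ : ℂ) ^ 2 := fun θ => by
    simp [g, w, h0, inner_self_eq_norm_sq_to_K]
  have hg0 : ∀ θ, g θ ≠ 0 := fun θ => by
    rw [hg]
    have h1 : (ε : ℂ) ≠ 0 := by exact_mod_cast hε0.ne'
    have h2 : (‖a‖ : ℂ) ≠ 0 := by exact_mod_cast ha0'.ne'
    exact mul_ne_zero (mul_ne_zero h1 (Circle.coe_ne_zero θ)) (pow_ne_zero _ h2)
  have hw0 : ∀ θ, ‖w θ‖ ≠ 0 := fun θ h => hg0 θ (by simp [g, norm_eq_zero.1 h])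
  have hw0' : ∀ θ, (‖w θ‖ : ℂ) ^ 2 ≠ 0 := fun θ => pow_ne_zero _ (by exact_mod_cast hw0 θ)
  let k : Circle → ℂ := fun θ => (starRingEnd ℂ) (g θ) / (‖w θ‖ : ℂ) ^ 2
  have hkc : Continuous k := by
    refine Continuous.div (Complex.continuous_conj.comp hgc) (by fun_prop) hw0'
  have hkg : ∀ θ, k θ * g θ = ((‖g θ‖ ^ 2 / ‖w θ‖ ^ 2 : ℝ) : ℂ) := fun θ => by
    simp only [k]
    rw [div_mul_eq_mul_div, Complex.conj_mul']
    push_cast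
    rfl
  obtain ⟨L, hLc, hL⟩ := hCC.exists_continuous_log hD (innerSL ℂ a) (-inner ℂ a p)
    (b := fun θ => p + k θ • w θ) (e := fun θ => p + w θ)
    (l := fun θ => ((Real.log (‖g θ‖ ^ 2 / ‖w θ‖ ^ 2) : ℝ) : ℂ)) (by fun_prop) (by fun_prop)
    (by
      refine Complex.continuous_ofReal.comp (Continuous.log ?_ fun θ => ?_)
      · exact Continuous.div (by fun_prop) (by fun_prop) fun θ => pow_ne_zero _ (hw0 θ)
      · exact div_ne_zero (pow_ne_zero _ (norm_ne_zero_iff.2 (hg0 θ))) (pow_ne_zero _ (hw0 θ)))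
    (fun θ => by
      apply hball
      rw [mem_ball_iff_norm']
      have h1 : u - (p + k θ • w θ) = a - k θ • w θ := by rw [ha]; abel
      rw [h1]
      refine lt_of_pow_lt_pow_left₀ 2 (norm_nonneg _) ?_
      rw [norm_sub_sq (𝕜 := ℂ), inner_smul_right]
      have h2 : k θ * inner ℂ a (w θ) = ((‖g θ‖ ^ 2 / ‖w θ‖ ^ 2 : ℝ) : ℂ) := hkg θ
      have h3 : ‖k θ • w θ‖ ^ 2 = ‖g θ‖ ^ 2 / ‖w θ‖ ^ 2 := by
        have := hw0 θ
        simp only [k, norm_smul, norm_div, RCLike.norm_conj, norm_pow, Complex.norm_real, norm_norm]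
        field_simp
      rw [h2, h3]
      have h4 : 0 < ‖g θ‖ ^ 2 / ‖w θ‖ ^ 2 := by
        have := norm_pos_iff.2 (hg0 θ)
        have := (norm_nonneg (w θ)).lt_of_ne' (hw0 θ)
        positivity
      simp only [RCLike.re_to_complex, Complex.ofReal_re]
      linarith)
    (fun θ => by
      apply hδD
      have h1 : p + w θ - q = ((ε : ℂ) * θ) • a := by simp only [w]; abel
      rw [mem_ball_iff_norm, h1, norm_smul, norm_mul, Circle.norm_coe, Complex.norm_real,
        Real.norm_of_nonneg hε0.le, hε]
      field_simp
      linarith)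
    (fun θ => by
      have h4 : 0 < ‖g θ‖ ^ 2 / ‖w θ‖ ^ 2 := by
        have := norm_pos_iff.2 (hg0 θ)
        have := (norm_nonneg (w θ)).lt_of_ne' (hw0 θ)
        positivity
      rw [← Complex.ofReal_exp, Real.exp_log h4, ← hkg]
      simp [inner_add_right, inner_smul_right, g])
    (fun θ t ht => by
      have h1 : p + k θ • w θ + t • (p + w θ - (p + k θ • w θ)) =
          p + (k θ + t * (1 - k θ)) • w θ := by module
      rw [h1] at ht ⊢
      have h2 : (innerSL ℂ a) (p + (k θ + t * (1 - k θ)) • w θ) + -inner ℂ a p =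
          (k θ + t * (1 - k θ)) * g θ := by
        simp [inner_add_right, inner_smul_right, g]
      rw [h2]
      refine mul_ne_zero (fun h => hp ?_) (hg0 θ)
      simpa [h] using ht)
  have hL' : ∀ θ, Complex.exp (L θ) = g θ := fun θ => by
    rw [hL]; simp [inner_add_right, g]
  have := isPreconnected_univ.eq_of_exp_eq
    (θ := fun t : ℝ => L (Circle.exp t) - t * Complex.I) (by fun_prop) (fun s _ t _ => by
      simp only [Complex.exp_sub, hL', hg, Circle.coe_exp]
      have h1 := Complex.exp_ne_zero (s * Complex.I)
      have h2 := Complex.exp_ne_zero (t * Complex.I)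
      field_simp) (mem_univ 0) (mem_univ (2 * Real.pi))
  simp [Circle.exp_two_pi, sub_eq_add_neg] at this

/-- Through every boundary point of a ℂ-convex open set passes a complex hyperplane which does not
meet the set. -/
theorem IsCConvex.exists_inner_ne_zero [ProperSpace E] (hCC : IsCConvex D) (hD : IsOpen D) {p : E}
    (hp : p ∈ frontier D) : ∃ ν : E, ‖ν‖ = 1 ∧ ∀ z ∈ D, inner ℂ ν (z - p) ≠ 0 := by
  have hpD : p ∉ D := fun h => by
    rw [hD.frontier_eq] at hp
    exact hp.2 h
  have hex : ∀ k : ℕ, ∃ y ν : E, dist y p < 2 * (1 / ((k : ℝ) + 1)) ∧ ‖ν‖ = 1 ∧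
      ∀ z ∈ D, inner ℂ ν (z - y) ≠ 0 := by
    intro k
    obtain ⟨x, hx, hxp⟩ := Metric.mem_closure_iff.1 (frontier_subset_closure hp) (1 / ((k : ℝ) + 1))
      (by positivity)
    obtain ⟨y, hy, hxy⟩ := hD.isClosed_compl.exists_infDist_eq_dist ⟨p, hpD⟩ x
    have hxp' : dist x y ≤ dist x p := hxy ▸ Metric.infDist_le_dist_of_mem (s := Dᶜ) hpD
    have hne : x - y ≠ 0 := sub_ne_zero.2 fun h => hy (h ▸ hx)
    refine ⟨y, ((‖x - y‖ : ℂ)⁻¹) • (x - y), ?_, norm_smul_inv_norm hne, fun z hz => ?_⟩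
    · have := dist_triangle y x p
      rw [dist_comm y x] at this
      rw [dist_comm] at hxp
      linarith
    · rw [inner_smul_left]
      refine mul_ne_zero (by simpa using hne) (hCC.inner_ne_zero_of_ball_subset hD hx ?_ hy hz)
      rw [← dist_eq_norm, ← hxy]
      exact Metric.ball_infDist_compl_subset
  choose y ν hy hν hyν using hex
  obtain ⟨ν₀, hν₀, s, hs, hlim⟩ := (isCompact_sphere (0 : E) 1).tendsto_subseq
    (x := ν) (fun k => by simp [hν])
  refine ⟨ν₀, by simpa using hν₀, fun z hz h => ?_⟩
  have hyp : Tendsto (fun k => y (s k)) atTop (𝓝 p) := by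
    refine Tendsto.comp (tendsto_iff_dist_tendsto_zero.2 ?_) hs.tendsto_atTop
    refine squeeze_zero (fun _ => dist_nonneg) (fun k => (hy k).le) ?_
    simpa using tendsto_one_div_add_atTop_nhds_zero_nat.const_mul (2 : ℝ)
  have hz' : Tendsto (fun k => z - inner ℂ (ν (s k)) (z - y (s k)) • ν (s k)) atTop (𝓝 z) := by
    have h1 : Tendsto (fun k => z - inner ℂ (ν (s k)) (z - y (s k)) • ν (s k)) atTop
        (𝓝 (z - inner ℂ ν₀ (z - p) • ν₀)) :=
      tendsto_const_nhds.sub ((hlim.inner (tendsto_const_nhds.sub hyp)).smul hlim)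
    simpa [h] using h1
  obtain ⟨k, hk⟩ := (hz'.eventually (hD.mem_nhds hz)).exists
  refine hyν (s k) _ hk ?_
  rw [sub_right_comm, inner_sub_right, inner_smul_right, inner_self_eq_norm_sq_to_K, hν]
  rw [RCLike.ofReal_one, one_pow, mul_one, sub_self]

end Hyperplane

section Peak

variable {E : Type*} [NormedAddCommGroup E] [NormedSpace ℂ E] {D : Set E}

/-- If `p` is isolated among the zeros in `closure D` of an affine function, where `D` is ℂ-convex,
then it is the only zero in `closure D`. -/
theorem IsCConvex.eq_of_isolated_zero [ProperSpace E] (hCC : IsCConvex D)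
    (φ : E →L[ℂ] ℂ) (c : ℂ) {p q : E} {U : Set E} (hU : IsOpen U) (hpU : p ∈ U)
    (hiso : ∀ z ∈ U ∩ closure D, φ z + c = 0 → z = p)
    (hp : p ∈ closure D) (hφp : φ p + c = 0) (hq : q ∈ closure D) (hφq : φ q + c = 0) : q = p := by
  by_contra hne
  have hd : 0 < dist q p := dist_pos.2 hne
  obtain ⟨r', hr'0, hr'U⟩ := Metric.isOpen_iff.1 hU p hpU
  set r := min (r' / 2) (dist q p / 2) with hr
  have hr0 : 0 < r := by positivity
  have hrr' : r < r' := (min_le_left _ _).trans_lt (by linarith)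
  have hrd : r ≤ dist q p / 2 := min_le_right _ _
  obtain ⟨m, hm, hmle⟩ : ∃ m > 0, ∀ z ∈ Metric.sphere p r ∩ closure D, m ≤ ‖φ z + c‖ := by
    have hK : IsCompact (Metric.sphere p r ∩ closure D) :=
      (isCompact_sphere p r).inter_right isClosed_closure
    rcases (Metric.sphere p r ∩ closure D).eq_empty_or_nonempty with he | hne
    · exact ⟨1, one_pos, by simp [he]⟩
    obtain ⟨z₀, hz₀, hmin⟩ := hK.exists_isMinOn hne (f := fun z => ‖φ z + c‖) (by fun_prop)
    refine ⟨‖φ z₀ + c‖, norm_pos_iff.2 fun h => ?_, fun z hz => hmin hz⟩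
    have hz₀r : dist z₀ p = r := hz₀.1
    have := hiso z₀ ⟨hr'U (by rw [Metric.mem_ball]; linarith), hz₀.2⟩ h
    rw [this, dist_self] at hz₀r
    linarith
  set T : ℝ := 2 * r / (dist q p / 4) with hT
  have hT0 : 0 < T := by positivity
  set η := m / (1 + 2 * T) with hη
  have hη0 : 0 < η := by positivity
  have hnear : ∀ z₀ ∈ closure D, φ z₀ + c = 0 → ∀ ρ > 0, ∃ x ∈ D, dist x z₀ < ρ ∧
      ‖φ x + c‖ < η := by
    intro z₀ hz₀ h0 ρ hρ
    have hc : ContinuousAt (fun z => ‖φ z + c‖) z₀ := by fun_prop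
    have h1 : ∀ᶠ z in 𝓝 z₀, ‖φ z + c‖ < η :=
      hc.eventually (gt_mem_nhds (by simpa [h0] using hη0))
    obtain ⟨x, ⟨hx1, hx2⟩, hxD⟩ :=
      mem_closure_iff_nhds.1 hz₀ _ (inter_mem h1 (Metric.ball_mem_nhds z₀ hρ))
    exact ⟨x, hxD, hx2, hx1⟩
  obtain ⟨x, hxD, hxp, hx⟩ := hnear p hp hφp r hr0
  obtain ⟨y, hyD, hyq, hy⟩ := hnear q hq hφq (dist q p / 4) (by positivity)
  have hyp : 3 / 4 * dist q p < dist y p := by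
    have := dist_triangle_left q p y
    linarith
  have hxy : y - x ≠ 0 := sub_ne_zero.2 fun h => by rw [h] at hyp; linarith
  have hL := (hCC _ ⟨x, y - x, hxy, rfl⟩ ⟨x, ⟨0, by simp⟩, hxD⟩).1.isPreconnected
  obtain ⟨z, ⟨⟨t, rfl⟩, hzD⟩, hz⟩ := hL.intermediate_value (f := fun z => dist z p)
    (a := x) (b := y) ⟨⟨0, by simp⟩, hxD⟩ ⟨⟨1, by simp⟩, hyD⟩ (by fun_prop)
    (show r ∈ Icc (dist x p) (dist y p) from ⟨hxp.le, by linarith⟩)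
  have hz : dist (x + t • (y - x)) p = r := hz
  have ht : ‖t‖ ≤ T := by
    have h1 : ‖t‖ * ‖y - x‖ ≤ 2 * r := by
      rw [← norm_smul]
      have : t • (y - x) = x + t • (y - x) - x := by abel
      rw [this, ← dist_eq_norm]
      have := dist_triangle_right (x + t • (y - x)) x p
      linarith
    have h2 : dist q p / 4 ≤ ‖y - x‖ := by
      rw [← dist_eq_norm]
      have := dist_triangle y x p
      linarith
    rw [hT, le_div_iff₀ (by positivity)]
    exact (mul_le_mul_of_nonneg_left h2 (norm_nonneg t)).trans h1
  have hval : φ (x + t • (y - x)) + c = (φ x + c) + t * ((φ y + c) - (φ x + c)) := by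
    simp; ring
  have hlt : ‖φ (x + t • (y - x)) + c‖ < m := by
    rw [hval]
    calc _ ≤ ‖φ x + c‖ + ‖t‖ * (‖φ y + c‖ + ‖φ x + c‖) := by
          refine (norm_add_le _ _).trans ?_
          rw [norm_mul]
          gcongr
          exact norm_sub_le _ _
      _ ≤ ‖φ x + c‖ + T * (η + η) := by gcongr
      _ < η + T * (η + η) := by gcongr
      _ = m := by rw [hη]; field_simp; ring
  exact absurd (hmle _ ⟨hz, subset_closure hzD⟩) (not_le.2 hlt)

/-- A continuous logarithm of an affine function has a limit at every normal boundary point which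
is not a zero. -/
theorem NormalAt.exists_tendsto_log {q : E} (hq : NormalAt D q) (hqD : q ∈ closure D)
    (φ : E →L[ℂ] ℂ) (c : ℂ) (hφq : φ q + c ≠ 0) {L : E → ℂ} (hL : ContinuousOn L D)
    (hexp : ∀ x ∈ D, Complex.exp (L x) = φ x + c) : ∃ l, Tendsto L (𝓝[D] q) (𝓝 l) := by
  have hquot : Continuous fun x => (φ x + c) / (φ q + c) := by fun_prop
  obtain ⟨V, hVo, hqV, -, hV⟩ := hq ((fun x => (φ x + c) / (φ q + c)) ⁻¹' Complex.slitPlane)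
    (Complex.isOpen_slitPlane.preimage hquot) (by simp [div_self hφq])
  obtain ⟨x₀, hx₀⟩ := mem_closure_iff.1 hqD V hVo hqV
  set S := (fun x => (φ x + c) / (φ q + c)) ⁻¹' Complex.slitPlane ∩ D with hS
  set k : E → ℂ := fun x => L x - Complex.log ((φ x + c) / (φ q + c)) with hk
  have hkc : ContinuousOn k S :=
    (hL.mono inter_subset_right).sub (hquot.continuousOn.clog fun x hx => hx.1)
  have hke : ∀ x ∈ S, Complex.exp (k x) = φ q + c := fun x hx => by
    have h1 : (φ x + c) / (φ q + c) ≠ 0 := Complex.slitPlane_ne_zero hx.1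
    have h2 : φ x + c ≠ 0 := fun h => h1 (by simp [h])
    simp only [hk]
    rw [Complex.exp_sub, hexp x hx.2, Complex.exp_log h1, div_div_cancel₀ h2]
  have hconst : ∀ x ∈ V ∩ D, k x = k x₀ := fun x hx => by
    obtain ⟨γ, hγ⟩ := hV x hx x₀ hx₀
    have := isPreconnected_univ.eq_of_exp_eq (θ := fun s => k (γ s))
      (hkc.comp_continuous γ.continuous hγ).continuousOn
      (fun s _ t _ => (hke _ (hγ s)).trans (hke _ (hγ t)).symm) (mem_univ 0) (mem_univ 1)
    simpa using this
  refine ⟨k x₀ + Complex.log ((φ q + c) / (φ q + c)), ?_⟩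
  have hlim : ContinuousAt (fun x => k x₀ + Complex.log ((φ x + c) / (φ q + c))) q :=
    continuousAt_const.add (hquot.continuousAt.clog (by simp [div_self hφq]))
  refine (hlim.tendsto.mono_left nhdsWithin_le_nhds).congr' ?_
  filter_upwards [self_mem_nhdsWithin, mem_nhdsWithin_of_mem_nhds (hVo.mem_nhds hqV)] with x hxD hxV
  rw [← hconst x ⟨hxV, hxD⟩]
  simp [hk]

/-- A boundary point which is the only zero in `closure D` of an affine function is a peak point,
provided that `D` is ℂ-convex, bounded and normal. -/
theorem IsCConvex.exists_peak_function [ProperSpace E] (hCC : IsCConvex D) (hD : IsOpen D)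
    (hBdd : Bornology.IsBounded D) (hNormal : ∀ q ∈ frontier D, NormalAt D q)
    (φ : E →L[ℂ] ℂ) (c : ℂ) {p : E} (hp : p ∈ closure D) (hφp : φ p + c = 0)
    (hne : ∀ x ∈ D, φ x + c ≠ 0) (huniq : ∀ q ∈ closure D, φ q + c = 0 → q = p) :
    ∃ f : E → ℂ, ContinuousOn f (closure D) ∧ DifferentiableOn ℂ f D ∧ f p = 1 ∧
      ∀ z ∈ closure D \ {p}, ‖f z‖ < 1 := by
  obtain ⟨L, hLd, hL⟩ := hCC.exists_log hD φ c hne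
  have hLc := hLd.continuousOn
  obtain ⟨M, hM⟩ : ∃ M, ∀ x ∈ closure D, ‖φ x + c‖ ≤ M :=
    hBdd.isCompact_closure.exists_bound_of_continuousOn (by fun_prop)
  have hre : ∀ x ∈ D, (L x).re = Real.log ‖φ x + c‖ := fun x hx => by
    rw [← hL x hx, Complex.norm_exp, Real.log_exp]
  set K : ℝ := Real.log M + 1 with hK
  have hLre : ∀ x ∈ D, (L x - K).re ≤ -1 := fun x hx => by
    have := Real.log_le_log (norm_pos_iff.2 (hne x hx)) (hM x (subset_closure hx))
    simp only [Complex.sub_re, Complex.ofReal_re, hre x hx, hK]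
    linarith
  have hlim : ∀ q ∈ closure D, q ≠ p → ∃ l : ℂ, l.re ≤ -1 ∧
      Tendsto (fun x => L x - K) (𝓝[D] q) (𝓝 l) := by
    intro q hq hqp
    have := mem_closure_iff_nhdsWithin_neBot.1 hq
    obtain ⟨l, hl⟩ : ∃ l, Tendsto L (𝓝[D] q) (𝓝 l) := by
      by_cases hqD : q ∈ D
      · exact ⟨_, hLc q hqD⟩
      · exact (hNormal q (by rw [hD.frontier_eq]; exact ⟨hq, hqD⟩)).exists_tendsto_log hq φ c
          (fun h => hqp (huniq q hq h)) hLc hL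
    have hl' : Tendsto (fun x => L x - K) (𝓝[D] q) (𝓝 (l - K)) := hl.sub tendsto_const_nhds
    refine ⟨l - K, le_of_tendsto ((Complex.continuous_re.tendsto _).comp hl') ?_, hl'⟩
    filter_upwards [self_mem_nhdsWithin] with x hx using hLre x hx
  set u : E → ℂ := fun x => Complex.exp (L x - K)⁻¹ with hu
  have hup : Tendsto u (𝓝[D] p) (𝓝 1) := by
    have h1 : Tendsto (fun x => (φ x + c)) (𝓝[D] p) (𝓝[≠] 0) := by
      refine tendsto_nhdsWithin_iff.2 ⟨?_, ?_⟩
      · have : ContinuousAt (fun x => (φ x + c)) p := by fun_prop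
        simpa [ContinuousAt, hφp] using this.tendsto.mono_left nhdsWithin_le_nhds
      · filter_upwards [self_mem_nhdsWithin] with x hx using hne x hx
    have h2 : Tendsto (fun x => Real.log ‖φ x + c‖ - K) (𝓝[D] p) atBot :=
      tendsto_atBot_add_const_right _ (-K)
        (Real.tendsto_log_nhdsGT_zero.comp (tendsto_norm_nhdsNE_zero.comp h1))
    have h3 : Tendsto (fun x => ‖L x - K‖) (𝓝[D] p) atTop := by
      refine tendsto_atTop_mono' _ ?_ (tendsto_abs_atBot_atTop.comp h2)
      filter_upwards [self_mem_nhdsWithin] with x hx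
      have := Complex.abs_re_le_norm (L x - K)
      simpa [hre x hx] using this
    have h4 : Tendsto (fun x => (L x - K)⁻¹) (𝓝[D] p) (𝓝 0) :=
      tendsto_inv₀_cobounded.comp (tendsto_norm_atTop_iff_cobounded.1 h3)
    have := (Complex.continuous_exp.tendsto 0).comp h4
    rwa [Complex.exp_zero] at this
  have huq : ∀ q ∈ closure D, q ≠ p → ∃ y : ℂ, ‖y‖ < 1 ∧ Tendsto u (𝓝[D] q) (𝓝 y) := by
    intro q hq hqp
    obtain ⟨l, hl1, hl⟩ := hlim q hq hqp
    have hl0 : l ≠ 0 := by rintro rfl; norm_num at hl1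
    refine ⟨Complex.exp l⁻¹, ?_, (Complex.continuous_exp.tendsto _).comp (hl.inv₀ hl0)⟩
    rw [Complex.norm_exp, Real.exp_lt_one_iff, Complex.inv_re]
    exact div_neg_of_neg_of_pos (by linarith) (Complex.normSq_pos.2 hl0)
  have hud : DifferentiableOn ℂ u D := by
    refine DifferentiableOn.cexp ((hLd.sub_const _).inv fun x hx h => ?_)
    have := hLre x hx
    rw [h] at this
    norm_num at this
  refine ⟨extendFrom D u, continuousOn_extendFrom subset_rfl fun q hq => ?_,
    hud.congr fun x hx => extendFrom_extends hud.continuousOn x hx, extendFrom_eq hp hup, ?_⟩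
  · by_cases hqp : q = p
    · exact ⟨1, hqp ▸ hup⟩
    · obtain ⟨y, -, hy⟩ := huq q hq hqp
      exact ⟨y, hy⟩
  · rintro z ⟨hz, hzp⟩
    obtain ⟨y, hy1, hy⟩ := huq z hz hzp
    rwa [extendFrom_eq hz hy]

end Peak

/-- Let `D` be a bounded ℂ-convex domain in ℂⁿ that is strictly ℂ-convex and normal.
Then every boundary point `p ∈ ∂D` is an `A(D)`-peak point: there is `f : ℂⁿ → ℂ`
continuous on `cl(D)`, holomorphic on `D`, with `f(p) = 1` and `|f(z)| < 1` for every
`z ∈ cl(D) \ {p}`. -/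
theorem strictlyCConvex_normal_peak_point {n : ℕ}
    (D : Set (EuclideanSpace ℂ (Fin n)))
    (hOpen : IsOpen D) (hConn : IsConnected D) (hBdd : Bornology.IsBounded D)
    (hCC : IsCConvex D)
    (hStrict : ∀ q ∈ frontier D, StrictlyCConvexAt D q)
    (hNormal : ∀ q ∈ frontier D, NormalAt D q) :
    ∀ p ∈ frontier D, ∃ f : EuclideanSpace ℂ (Fin n) → ℂ,
      ContinuousOn f (closure D) ∧ DifferentiableOn ℂ f D ∧ f p = 1 ∧
      ∀ z ∈ closure D \ {p}, ‖f z‖ < 1 := by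
  intro p hp
  obtain ⟨ν, hν, hνD⟩ := hCC.exists_inner_ne_zero hOpen hp
  have hν0 : innerSL ℂ ν ≠ 0 := fun h => by
    have h1 : ‖innerSL ℂ ν‖ = 1 := by rw [innerSL_apply_norm, hν]
    simp [h] at h1
  have hinner : ∀ z, innerSL ℂ ν z + -inner ℂ ν p = inner ℂ ν (z - p) := fun z => by
    simp [sub_eq_add_neg]
  have hne : ∀ z ∈ D, innerSL ℂ ν z + -inner ℂ ν p ≠ 0 := fun z hz => by
    rw [hinner]
    exact hνD z hz
  have hpcl := frontier_subset_closure hp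
  have hφp : innerSL ℂ ν p + -inner ℂ ν p = 0 := by simp
  obtain ⟨U, hU, hpU, hUH⟩ := hStrict p hp
  have hH := hUH {x | innerSL ℂ ν x = inner ℂ ν p} ⟨_, _, hν0, rfl⟩ (by simp) (by
    refine eq_empty_of_forall_notMem fun z hz => hne z hz.2 ?_
    rw [hz.1, add_neg_cancel])
  refine hCC.exists_peak_function hOpen hBdd hNormal _ _ hpcl hφp hne fun q hq hφq =>
    hCC.eq_of_isolated_zero _ _ hU hpU (fun z hz h => ?_) hpcl hφp hq hφq
  have : z ∈ U ∩ closure D ∩ {x | innerSL ℂ ν x = inner ℂ ν p} :=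
    ⟨hz, by rwa [← sub_eq_add_neg, sub_eq_zero] at h⟩
  rwa [hH] at this
end

section
/- Let D be a bounded strictly ℂ-convex domain in ℂⁿ with C¹-smooth boundary. Then every boundary point of D is normal, i.e. D is a normal domain. -/
open Set Topology Filter

/-- Near a regular point of a strictly differentiable real function, points of a strict sublevel
set can be joined inside that sublevel set within a prescribed neighborhood. -/
theorem HasStrictFDerivAt.exists_isOpen_joinedIn_sublevel {E : Type*} [NormedAddCommGroup E]
    [NormedSpace ℝ E] [CompleteSpace E] {f : E → ℝ} {f' : E →L[ℝ] ℝ} {a : E}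
    (hf : HasStrictFDerivAt f f' a) (hf' : f' ≠ 0) (c : ℝ) {W : Set E} (hW : IsOpen W)
    (haW : a ∈ W) :
    ∃ V : Set E, IsOpen V ∧ a ∈ V ∧ V ⊆ W ∧
      ∀ x ∈ V, f x < c → ∀ y ∈ V, f y < c → JoinedIn (W ∩ {z | f z < c}) x y := by
  have hrange : f'.range = ⊤ := by
    refine LinearMap.range_eq_top.2 (LinearMap.surjective ?_)
    exact fun h => hf' (ContinuousLinearMap.coe_injective h)
  set φ := hf.implicitToOpenPartialHomeomorph f f' hrange
  have hφ : ∀ x, (φ x).1 = f x := hf.implicitToOpenPartialHomeomorph_fst hrange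
  have ha : a ∈ φ.source := hf.mem_implicitToOpenPartialHomeomorph_source hrange
  have hN : φ.target ∩ φ.symm ⁻¹' W ∈ 𝓝 (φ a) :=
    (φ.symm.isOpen_inter_preimage hW).mem_nhds
      ⟨φ.map_source ha, by simpa [φ.left_inv ha] using haW⟩
  obtain ⟨ε, hε, hball⟩ := Metric.mem_nhds_iff.1 hN
  refine ⟨φ.source ∩ φ ⁻¹' Metric.ball (φ a) ε, φ.isOpen_inter_preimage Metric.isOpen_ball,
    ⟨ha, Metric.mem_ball_self hε⟩, fun x hx => ?_, fun x hx hxc y hy hyc => ?_⟩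
  · simpa [φ.left_inv hx.1] using (hball hx.2).2
  · have hconv : Convex ℝ (Metric.ball (φ a) ε ∩ {z | z.1 < c}) :=
      (convex_ball _ _).inter (convex_halfSpace_lt (LinearMap.fst ℝ ℝ f'.ker).isLinear c)
    have hx' : φ x ∈ Metric.ball (φ a) ε ∩ {z | z.1 < c} := ⟨hx.2, (hφ x).trans_lt hxc⟩
    have hy' : φ y ∈ Metric.ball (φ a) ε ∩ {z | z.1 < c} := ⟨hy.2, (hφ y).trans_lt hyc⟩
    have hcont : ContinuousOn φ.symm (Metric.ball (φ a) ε ∩ {z | z.1 < c}) :=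
      φ.continuousOn_symm.mono fun z hz => (hball hz.1).1
    have hjoin := ((hconv.isPathConnected ⟨_, hx'⟩).joinedIn _ hx' _ hy').map_continuousOn hcont
    rw [φ.left_inv hx.1, φ.left_inv hy.1] at hjoin
    refine hjoin.mono (image_subset_iff.2 fun z hz => ⟨(hball hz.1).2, ?_⟩)
    change f (φ.symm z) < c
    rw [← hφ, φ.right_inv (hball hz.1).1]
    exact hz.2

/-- Let `D` be a bounded strictly ℂ-convex domain in ℂⁿ with `C¹`-smooth boundary (given by
a `C¹` defining function `ρ` on a neighborhood `U` of `∂D` with nowhere vanishing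
derivative). Then every boundary point of `D` is normal, i.e. `D` is a normal domain. -/
theorem strictlyCConvex_C1_normal {n : ℕ}
    (D : Set (EuclideanSpace ℂ (Fin n)))
    (hOpen : IsOpen D) (hConn : IsConnected D) (hBdd : Bornology.IsBounded D)
    (hStrict : ∀ q ∈ frontier D, StrictlyCConvexAt D q)
    (U : Set (EuclideanSpace ℂ (Fin n))) (ρ : EuclideanSpace ℂ (Fin n) → ℝ)
    (hU : IsOpen U) (hfrU : frontier D ⊆ U)
    (hρ : ContDiffOn ℝ 1 ρ U)
    (hzero : frontier D = {z ∈ U | ρ z = 0})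
    (hneg : D ∩ U = {z ∈ U | ρ z < 0})
    (hd : ∀ z ∈ U, fderiv ℝ ρ z ≠ 0) :
    ∀ p ∈ frontier D, NormalAt D p := by
  intro p hp W hW hpW
  have hpU : p ∈ U := hfrU hp
  have hstrict : HasStrictFDerivAt ρ (fderiv ℝ ρ p) p :=
    (hρ.contDiffAt (hU.mem_nhds hpU)).hasStrictFDerivAt one_ne_zero
  obtain ⟨V, hV, hpV, hVW, hjoin⟩ :=
    hstrict.exists_isOpen_joinedIn_sublevel (hd p hpU) 0 (hW.inter hU) ⟨hpW, hpU⟩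
  have hρneg : ∀ x ∈ V ∩ D, ρ x < 0 := fun x hx => (hneg.subset ⟨hx.2, (hVW hx.1).2⟩).2
  refine ⟨V, hV, hpV, hVW.trans inter_subset_left, fun x hx y hy => ?_⟩
  refine (hjoin x hx.1 (hρneg x hx) y hy.1 (hρneg y hy)).mono fun z hz => ⟨hz.1.1, ?_⟩
  exact (hneg.superset ⟨hz.1.2, hz.2⟩).1
end

section
/- Let D ⊆ ℂ be a bounded simply connected domain every boundary point of which is normal. Then D is fat, i.e. D equals the interior of its closure. -/
open Set Topology Filter

/-- A continuous function on a preconnected set with `exp ∘ h = 1` is constant. -/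
lemma IsPreconnected.constant_of_exp_eq_one {X : Type*} [TopologicalSpace X] {S : Set X}
    (hS : IsPreconnected S) {h : X → ℂ} (hc : ContinuousOn h S)
    (h1 : ∀ x ∈ S, Complex.exp (h x) = 1) {x y : X} (hx : x ∈ S) (hy : y ∈ S) :
    h x = h y := by
  wlog hxy : (h x).im ≤ (h y).im generalizing x y
  · exact (this hy hx (le_of_not_ge hxy)).symm
  obtain ⟨n, hn⟩ := Complex.exp_eq_one_iff.1 (h1 x hx)
  obtain ⟨m, hm⟩ := Complex.exp_eq_one_iff.1 (h1 y hy)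
  have im_eq (k : ℤ) : ((k : ℂ) * (2 * Real.pi * Complex.I)).im = k * (2 * Real.pi) := by simp
  by_contra hne
  have hnm : n ≠ m := fun e ↦ hne (by rw [hn, hm, e])
  rw [hn, hm, im_eq, im_eq] at hxy
  have hpi := Real.pi_pos
  have hle : n ≤ m := by
    have : (n : ℝ) ≤ m := le_of_mul_le_mul_right hxy (by positivity)
    exact_mod_cast this
  have hlt : (n : ℝ) + 1 ≤ m := by exact_mod_cast lt_of_le_of_ne hle hnm
  have hmem : (n : ℝ) * (2 * Real.pi) + Real.pi ∈ Icc (h x).im (h y).im := by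
    rw [hn, hm, im_eq, im_eq]
    constructor <;> nlinarith
  obtain ⟨z, hz, hzeq⟩ :=
    hS.intermediate_value hx hy (Complex.continuous_im.comp_continuousOn hc) hmem
  obtain ⟨k, hk⟩ := Complex.exp_eq_one_iff.1 (h1 z hz)
  simp only [Function.comp_apply, hk, im_eq] at hzeq
  have h2 : (2 * k : ℝ) = 2 * n + 1 := by
    apply mul_right_cancel₀ hpi.ne'
    linarith
  have h3 : 2 * k = 2 * n + 1 := by exact_mod_cast h2
  omega

/-- There is no continuous branch of `log (z - p)` on a circle centred at `p`. -/
lemma not_exists_log_branch_on_sphere (p : ℂ) {r : ℝ} (hr : 0 < r) {F : ℂ → ℂ}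
    (hF : ContinuousOn F (Metric.sphere p r))
    (hexp : ∀ z ∈ Metric.sphere p r, Complex.exp (F z) = z - p) : False := by
  have hmem (t : ℝ) : circleMap p r t ∈ Metric.sphere p r := circleMap_mem_sphere p hr.le t
  have hc : Continuous fun t : ℝ ↦ F (circleMap p r t) - Real.log r - t * Complex.I :=
    ((hF.comp_continuous (continuous_circleMap p r) hmem).sub continuous_const).sub (by fun_prop)
  have key := isPreconnected_univ.constant_of_exp_eq_one hc.continuousOn (fun t _ ↦ by
    have hr' : (r : ℂ) ≠ 0 := by exact_mod_cast hr.ne'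
    rw [Complex.exp_sub, Complex.exp_sub, hexp _ (hmem t), ← Complex.ofReal_exp,
      Real.exp_log hr, circleMap_sub_center, circleMap_zero]
    field_simp [Complex.exp_ne_zero]) (mem_univ 0) (mem_univ (2 * Real.pi))
  have hper : circleMap p r (2 * Real.pi) = circleMap p r 0 := by
    simpa using periodic_circleMap p r 0
  have him := congrArg Complex.im key
  simp only [hper, Complex.sub_im, Complex.ofReal_im, Complex.im_ofReal_mul,
    Complex.I_im] at him
  linarith [Real.pi_pos]

/-- A continuous branch of `log (z - p)` on `D` has a limit at every normal boundary point of `D`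
other than `p`. -/
lemma NormalAt.exists_tendsto_log_branch {D : Set ℂ} {p x : ℂ} (hx : NormalAt D x)
    (hxD : x ∈ closure D) (hxp : x ≠ p) {f : ℂ → ℂ} (hf : ContinuousOn f D)
    (hexp : ∀ z ∈ D, Complex.exp (f z) = z - p) :
    ∃ y, Tendsto f (𝓝[D] x) (𝓝 y) := by
  have hx0 : x - p ≠ 0 := sub_ne_zero.2 hxp
  let q : ℂ → ℂ := fun z ↦ (z - p) / (x - p)
  have hq : Continuous q := by fun_prop
  have hqx : q x = 1 := div_self hx0
  let U : Set ℂ := q ⁻¹' Complex.slitPlane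
  have hxU : x ∈ U := by simp [U, hqx]
  let g : ℂ → ℂ := fun z ↦ Complex.log (q z) + Complex.log (x - p)
  have hg : ContinuousOn g U :=
    (hq.continuousOn.clog fun z hz ↦ hz).add continuousOn_const
  have hgexp : ∀ z ∈ U, Complex.exp (g z) = z - p := fun z hz ↦ by
    rw [Complex.exp_add, Complex.exp_log (Complex.slitPlane_ne_zero hz), Complex.exp_log hx0]
    exact div_mul_cancel₀ _ hx0
  have hUo : IsOpen U := Complex.isOpen_slitPlane.preimage hq
  obtain ⟨V, hVo, hxV, -, hV⟩ := hx U hUo hxU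
  obtain ⟨w, hwV, hwD⟩ := mem_closure_iff.1 hxD V hVo hxV
  have hconst : ∀ z ∈ V ∩ D, f w - g w = f z - g z := fun z hz ↦ by
    obtain ⟨γ, hγ⟩ := hV w ⟨hwV, hwD⟩ z hz
    have hsub : range γ ⊆ U ∩ D := range_subset_iff.2 hγ
    refine (isPreconnected_range γ.continuous).constant_of_exp_eq_one
      (h := fun z ↦ f z - g z) ((hf.mono fun v hv ↦ (hsub hv).2).sub
        (hg.mono fun v hv ↦ (hsub hv).1)) (fun v hv ↦ ?_) γ.source_mem_range γ.target_mem_range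
    rw [Complex.exp_sub, hexp v (hsub hv).2, ← hgexp v (hsub hv).1]
    exact div_self (Complex.exp_ne_zero _)
  refine ⟨g x + (f w - g w), Tendsto.congr' ?_
    (((hg.continuousAt (hUo.mem_nhds hxU)).tendsto.mono_left nhdsWithin_le_nhds).add_const _)⟩
  filter_upwards [self_mem_nhdsWithin, mem_nhdsWithin_of_mem_nhds (hVo.mem_nhds hxV)]
    with z hzD hzV
  rw [hconst z ⟨hzV, hzD⟩]
  ring

/-- Let `D ⊆ ℂ` be a bounded simply connected domain every boundary point of which is
normal. Then `D` is fat, i.e. `D` equals the interior of its closure. -/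
theorem normal_simplyConnected_fat
    (D : Set ℂ)
    (hOpen : IsOpen D) (hConn : IsConnected D) (hBdd : Bornology.IsBounded D)
    (hSC : SimplyConnectedSpace ↥D)
    (hNormal : ∀ p ∈ frontier D, NormalAt D p) :
    D = interior (closure D) := by
  refine (interior_maximal subset_closure hOpen).antisymm fun p hp ↦ ?_
  by_contra hpD
  have hsc : IsSimplyConnected D := hSC
  obtain ⟨f, hf, hfexp⟩ := Complex.exists_continuousOn_eqOn_exp_comp hsc hOpen
    (g := fun z ↦ z - p) (by fun_prop) (by
      rintro ⟨z, hz, hzp⟩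
      exact hpD (sub_eq_zero.1 hzp ▸ hz))
  obtain ⟨r, hr, hball⟩ := Metric.nhds_basis_closedBall.mem_iff.1 (isOpen_interior.mem_nhds hp)
  have hsub : Metric.sphere p r ⊆ closure D :=
    Metric.sphere_subset_closedBall.trans (hball.trans interior_subset)
  have hlim : ∀ x ∈ Metric.sphere p r, ∃ y, Tendsto f (𝓝[D] x) (𝓝 y) := fun x hx ↦ by
    by_cases hxD : x ∈ D
    · exact ⟨f x, hf x hxD⟩
    · have hxF : x ∈ frontier D := ⟨hsub hx, by rwa [hOpen.interior_eq]⟩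
      exact (hNormal x hxF).exists_tendsto_log_branch (hsub hx)
        (Metric.ne_of_mem_sphere hx hr.ne') hf hfexp
  refine not_exists_log_branch_on_sphere p hr (continuousOn_extendFrom hsub hlim) fun x hx ↦ ?_
  have : (𝓝[D] x).NeBot := mem_closure_iff_nhdsWithin_neBot.1 (hsub hx)
  have hexp := (Complex.continuous_exp.tendsto _).comp (tendsto_extendFrom (hlim x hx))
  refine tendsto_nhds_unique (hexp.congr' ?_)
    ((continuous_id.sub continuous_const).continuousWithinAt (s := D) (x := x))
  filter_upwards [self_mem_nhdsWithin] with z hz using hfexp hz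
end

section
/- Let D ⊆ ℂ^{n+m} be a C^k-smooth strongly linearly convex bounded domain with k ≥ 2, and let π : ℂ^{n+m} → ℂⁿ be the projection onto the first n coordinates. Then the shadow π(D) is a C^k-smooth strongly linearly convex bounded domain in ℂⁿ. -/
open Set Topology Filter

section RealCalculus

variable {G : Type*} [NormedAddCommGroup G] [NormedSpace ℝ G]

theorem ContDiffAt.eventually_lt_of_secondDeriv_pos {f : G → ℝ} {z : G} (hf : ContDiffAt ℝ 2 f z)
    {c : ℝ} (hc : 0 < c) {S : Set G}
    (hS : ∀ X ∈ S, fderiv ℝ f z X = 0 ∧ c * ‖X‖ ^ 2 ≤ fderiv ℝ (fderiv ℝ f) z X X) :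
    ∀ᶠ y in 𝓝 z, y - z ∈ S → y ≠ z → f z < f y := by
  have hd : DifferentiableAt ℝ (fderiv ℝ f) z :=
    (hf.fderiv_right (m := 1) (by norm_num)).differentiableAt (by norm_num)
  have h1 : ∀ᶠ x in 𝓝 z, DifferentiableAt ℝ f x :=
    (hf.eventually (by simp)).mono fun x hx => hx.differentiableAt (by norm_num)
  have h2 := hd.hasFDerivAt.isLittleO.bound (half_pos hc)
  obtain ⟨r, hr, hball⟩ := Metric.eventually_nhds_iff_ball.1 (h1.and h2)
  filter_upwards [Metric.ball_mem_nhds z hr] with y hy hyS hne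
  obtain ⟨hX0, hX2⟩ := hS _ hyS
  set X := y - z with hX
  have hXpos : 0 < ‖X‖ := norm_pos_iff.2 (sub_ne_zero.2 hne)
  have hXr : ‖X‖ < r := by rwa [hX, ← dist_eq_norm]
  have hmem : ∀ s ∈ Icc (0 : ℝ) 1, z + s • X ∈ Metric.ball z r := by
    intro s hs
    rw [Metric.mem_ball, dist_eq_norm, add_sub_cancel_left, norm_smul, Real.norm_of_nonneg hs.1]
    nlinarith [hs.2]
  have hder : ∀ s ∈ Icc (0 : ℝ) 1,
      HasDerivAt (fun s : ℝ => f (z + s • X)) (fderiv ℝ f (z + s • X) X) s := by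
    intro s hs
    have hl : HasDerivAt (fun s : ℝ => z + s • X) X s := by
      simpa using ((hasDerivAt_id s).smul_const X).const_add z
    exact (hball _ (hmem s hs)).1.hasFDerivAt.comp_hasDerivAt s hl
  have hmono : StrictMonoOn (fun s : ℝ => f (z + s • X)) (Icc 0 1) := by
    refine strictMonoOn_of_deriv_pos (convex_Icc 0 1)
      (fun s hs => (hder s hs).continuousAt.continuousWithinAt) fun s hs => ?_
    rw [interior_Icc] at hs
    have hs' := Ioo_subset_Icc_self hs
    rw [(hder s hs').deriv]
    have hb := (hball _ (hmem s hs')).2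
    rw [add_sub_cancel_left, norm_smul, Real.norm_of_nonneg hs.1.le] at hb
    have hb2 := ((ContinuousLinearMap.le_opNorm _ X).trans
      (mul_le_mul_of_nonneg_right hb hXpos.le))
    rw [Real.norm_eq_abs, abs_le] at hb2
    have hb3 := hb2.1
    simp only [sub_apply, map_smul, smul_apply,
      smul_eq_mul, hX0] at hb3
    have : 0 < c * (s * ‖X‖ ^ 2) := by have := hs.1; positivity
    have := mul_le_mul_of_nonneg_left hX2 hs.1.le
    nlinarith
  have := hmono (left_mem_Icc.2 zero_le_one) (right_mem_Icc.2 zero_le_one) zero_lt_one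
  simpa [hX] using this

/-- Near a point where `f` decreases strictly in some direction, any point of `{f ≤ 0}` is a limit
of points which can be joined inside `{f < 0}` to a given point of `{f < 0}`. -/
theorem ContDiffAt.exists_nhds_joinedIn_sublevel {f : G → ℝ} {x e : G} (hf : ContDiffAt ℝ 1 f x)
    (hx : f x = 0) (he : fderiv ℝ f x e < 0) {W : Set G} (hW : W ∈ 𝓝 x) :
    ∃ V ∈ 𝓝 x, ∀ s ∈ V, ∀ t ∈ V, f s < 0 → f t ≤ 0 →
      t ∈ closure {y | JoinedIn (W ∩ {y | f y < 0}) s y} := by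
  have h1 : ∀ᶠ y in 𝓝 x, DifferentiableAt ℝ f y :=
    (hf.eventually (by simp)).mono fun y hy => hy.differentiableAt (by norm_num)
  have h2 : ∀ᶠ y in 𝓝 x, fderiv ℝ f y e < 0 := by
    have : ContinuousAt (fun y => fderiv ℝ f y e) x :=
      (hf.fderiv_right (m := 0) (by norm_num)).continuousAt.clm_apply continuousAt_const
    exact this.eventually (gt_mem_nhds he)
  obtain ⟨R, hR, hball⟩ := Metric.eventually_nhds_iff_ball.1 ((h1.and h2).and hW)
  obtain ⟨δ, hδ, hδR⟩ : ∃ δ > 0, δ * ‖e‖ < R / 2 := by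
    refine ⟨R / 2 / (‖e‖ + 1), by positivity, ?_⟩
    rw [div_mul_eq_mul_div, div_lt_iff₀ (by positivity)]
    nlinarith [norm_nonneg e]
  have hmem : ∀ s ∈ Metric.ball x (R / 2), ∀ τ ∈ Icc 0 δ, s + τ • e ∈ Metric.ball x R := by
    intro s hs τ hτ
    rw [Metric.mem_ball, dist_eq_norm] at hs ⊢
    have : s + τ • e - x = (s - x) + τ • e := by abel
    rw [this]
    refine (norm_add_le _ _).trans_lt ?_
    rw [norm_smul, Real.norm_of_nonneg hτ.1]
    nlinarith [hτ.2, norm_nonneg e]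
  have hneg : ∀ s ∈ Metric.ball x (R / 2), f s ≤ 0 → ∀ τ ∈ Ioc 0 δ, f (s + τ • e) < 0 := by
    intro s hs hs0 τ hτ
    have hder : ∀ σ ∈ Icc (0 : ℝ) δ,
        HasDerivAt (fun σ : ℝ => f (s + σ • e)) (fderiv ℝ f (s + σ • e) e) σ := by
      intro σ hσ
      have hl : HasDerivAt (fun σ : ℝ => s + σ • e) e σ := by
        simpa using ((hasDerivAt_id σ).smul_const e).const_add s
      exact (hball _ (hmem s hs σ hσ)).1.1.hasFDerivAt.comp_hasDerivAt σ hl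
    have hanti : StrictAntiOn (fun σ : ℝ => f (s + σ • e)) (Icc 0 δ) := by
      refine strictAntiOn_of_deriv_neg (convex_Icc 0 δ)
        (fun σ hσ => (hder σ hσ).continuousAt.continuousWithinAt) fun σ hσ => ?_
      rw [interior_Icc] at hσ
      have hσ' := Ioo_subset_Icc_self hσ
      rw [(hder σ hσ').deriv]
      exact (hball _ (hmem s hs σ hσ')).1.2
    have := hanti (left_mem_Icc.2 hδ.le) (Ioc_subset_Icc_self hτ) hτ.1
    simp only [zero_smul, add_zero] at this
    exact this.trans_le hs0
  have hxδ : f (x + δ • e) < 0 :=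
    hneg x (Metric.mem_ball_self (half_pos hR)) hx.le δ ⟨hδ, le_rfl⟩
  have hxR : x + δ • e ∈ Metric.ball x R :=
    hmem x (Metric.mem_ball_self (half_pos hR)) δ ⟨hδ.le, le_rfl⟩
  have hcont : ContinuousAt f (x + δ • e) := (hball _ hxR).1.1.continuousAt
  obtain ⟨η, hη, hηball⟩ := Metric.eventually_nhds_iff_ball.1
    ((hcont.eventually (gt_mem_nhds hxδ)).and (Metric.isOpen_ball.mem_nhds hxR))
  refine ⟨Metric.ball x (min η (R / 2)), Metric.ball_mem_nhds _ (by positivity), ?_⟩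
  intro s hs t ht hs0 ht0
  have hsub := Metric.ball_subset_ball (x := x) (min_le_right η (R / 2))
  have key : ∀ τ ∈ Ioc 0 δ, JoinedIn (W ∩ {y | f y < 0}) s (t + τ • e) := by
    intro τ hτ
    have j1 : JoinedIn (W ∩ {y | f y < 0}) s (s + δ • e) := by
      refine JoinedIn.of_segment_subset ?_
      rw [segment_eq_image']
      rintro _ ⟨θ, hθ, rfl⟩
      simp only [add_sub_cancel_left, smul_smul]
      have hm : θ * δ ∈ Icc 0 δ := ⟨by nlinarith [hθ.1], by nlinarith [hθ.2]⟩
      refine ⟨(hball _ (hmem s (hsub hs) _ hm)).2, ?_⟩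
      rcases hm.1.eq_or_lt with h | h
      · simpa [← h] using hs0
      · exact hneg s (hsub hs) hs0.le _ ⟨h, hm.2⟩
    have j2 : JoinedIn (W ∩ {y | f y < 0}) (s + δ • e) (t + δ • e) := by
      refine JoinedIn.of_segment_subset ?_
      have hshift : ∀ u ∈ Metric.ball x (min η (R / 2)), u + δ • e ∈ Metric.ball (x + δ • e) η := by
        intro u hu
        have := hu.trans_le (min_le_left η (R / 2))
        simpa using this
      refine ((convex_ball _ _).segment_subset (hshift s hs) (hshift t ht)).trans ?_
      exact fun y hy => ⟨(hball _ (hηball y hy).2).2, (hηball y hy).1⟩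
    have j3 : JoinedIn (W ∩ {y | f y < 0}) (t + δ • e) (t + τ • e) := by
      refine (JoinedIn.of_segment_subset ?_).symm
      rw [segment_eq_image']
      rintro _ ⟨θ, hθ, rfl⟩
      have heq : t + τ • e + θ • (t + δ • e - (t + τ • e)) = t + (τ + θ * (δ - τ)) • e := by
        module
      simp only [heq]
      have hm : τ + θ * (δ - τ) ∈ Ioc 0 δ :=
        ⟨by nlinarith [hθ.1, hτ.1, hτ.2], by nlinarith [hθ.2, hτ.2]⟩
      exact ⟨(hball _ (hmem t (hsub ht) _ (Ioc_subset_Icc_self hm))).2, hneg t (hsub ht) ht0 _ hm⟩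
    exact (j1.trans j2).trans j3
  have htend : Tendsto (fun τ : ℝ => t + τ • e) (𝓝[>] 0) (𝓝 t) := by
    have : Continuous fun τ : ℝ => t + τ • e := by fun_prop
    simpa using (this.tendsto 0).mono_left nhdsWithin_le_nhds
  exact mem_closure_of_tendsto htend
    (mem_of_superset (Ioc_mem_nhdsGT hδ) key)

end RealCalculus

section ComplexLines

variable {G : Type*} [NormedAddCommGroup G] [NormedSpace ℂ G]

theorem wirtingerDeriv_eq_zero_iff {ρ : G → ℝ} {z X : G} :
    wirtingerDeriv ρ z X = 0 ↔ fderiv ℝ ρ z X = 0 ∧ fderiv ℝ ρ z (Complex.I • X) = 0 := by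
  simp [wirtingerDeriv, Complex.ext_iff]

theorem real_I_smul (t : ℂ) (X : G) : t • X = t.re • X + t.im • (Complex.I • X) := by
  conv_lhs => rw [← Complex.re_add_im t]
  rw [add_smul, mul_smul]
  rfl

theorem wirtingerDeriv_smul_eq_zero {ρ : G → ℝ} {z X : G} (h : wirtingerDeriv ρ z X = 0) (t : ℂ) :
    wirtingerDeriv ρ z (t • X) = 0 := by
  rw [wirtingerDeriv_eq_zero_iff] at h ⊢
  rw [smul_smul, real_I_smul t, real_I_smul (Complex.I * t)]
  simp [h.1, h.2]

theorem exists_fderiv_smul_neg {ρ : G → ℝ} {z X : G} (h : wirtingerDeriv ρ z X ≠ 0) :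
    ∃ t : ℂ, fderiv ℝ ρ z (t • X) < 0 := by
  by_contra! hcon
  refine h (wirtingerDeriv_eq_zero_iff.2 ⟨?_, ?_⟩)
  · have h1 := hcon 1
    have h2 := hcon (-1)
    simp at h1 h2
    linarith
  · have h1 := hcon Complex.I
    have h2 := hcon (-Complex.I)
    simp at h1 h2
    linarith

/-- The set of complex parameters `t` for which the point `a + t (b - a)` of the complex line
through `a` and `b` lies in `D`. -/
def lineSlice (D : Set G) (a b : G) : Set ℂ := {t | a + t • (b - a) ∈ D}

theorem IsOpen.lineSlice {D : Set G} (hD : IsOpen D) (a b : G) : IsOpen (lineSlice D a b) :=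
  hD.preimage (by fun_prop : Continuous fun t : ℂ => a + t • (b - a))

theorem IsClosed.lineSlice {D : Set G} (hD : IsClosed D) (a b : G) : IsClosed (lineSlice D a b) :=
  hD.preimage (by fun_prop : Continuous fun t : ℂ => a + t • (b - a))

@[simp] theorem zero_mem_lineSlice {D : Set G} {a b : G} : 0 ∈ lineSlice D a b ↔ a ∈ D := by
  simp [lineSlice]

@[simp] theorem one_mem_lineSlice {D : Set G} {a b : G} : 1 ∈ lineSlice D a b ↔ b ∈ D := by
  simp [lineSlice]

/-- Slices of a bounded closed set are upper semicontinuous in the line. -/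
theorem eventually_lineSlice_subset {C : Set G} (hC : IsClosed C) (hBdd : Bornology.IsBounded C)
    {a b : G} (hab : a ≠ b) {W : Set ℂ} (hW : IsOpen W) (h : lineSlice C a b ⊆ W) :
    ∀ᶠ p : G × G in 𝓝 (a, b), lineSlice C p.1 p.2 ⊆ W := by
  obtain ⟨R, hR0, hR⟩ := hBdd.exists_pos_norm_le
  have hd : 0 < ‖b - a‖ := norm_pos_iff.2 (sub_ne_zero.2 hab.symm)
  have e1 : ∀ᶠ p : G × G in 𝓝 (a, b), ‖b - a‖ / 2 < ‖p.2 - p.1‖ :=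
    (by fun_prop : Continuous fun p : G × G => ‖p.2 - p.1‖).continuousAt.eventually
      (lt_mem_nhds (half_lt_self hd))
  have e2 : ∀ᶠ p : G × G in 𝓝 (a, b), ‖p.1‖ < ‖a‖ + 1 :=
    (by fun_prop : Continuous fun p : G × G => ‖p.1‖).continuousAt.eventually
      (gt_mem_nhds (lt_add_one _))
  set M := (R + (‖a‖ + 1)) / (‖b - a‖ / 2)
  have hK : IsCompact (Metric.closedBall (0 : ℂ) M \ W) := (isCompact_closedBall 0 M).diff hW
  have e3 : ∀ᶠ p : G × G in 𝓝 (a, b), ∀ t ∈ Metric.closedBall (0 : ℂ) M \ W,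
      p.1 + t • (p.2 - p.1) ∉ C := by
    refine hK.eventually_forall_of_forall_eventually fun t ht => ?_
    have hc : Continuous fun q : (G × G) × ℂ => q.1.1 + q.2 • (q.1.2 - q.1.1) := by fun_prop
    have hn : a + t • (b - a) ∉ C := fun hmem => ht.2 (h hmem)
    exact (hc.tendsto ((a, b), t)).eventually (hC.isOpen_compl.mem_nhds hn)
  filter_upwards [e1, e2, e3] with p h1 h2 h3 t ht
  by_contra htW
  refine h3 t ⟨?_, htW⟩ ht
  rw [mem_closedBall_zero_iff, le_div_iff₀ (half_pos hd)]
  have h4 : ‖t‖ * ‖p.2 - p.1‖ ≤ R + ‖p.1‖ := by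
    rw [← norm_smul]
    calc ‖t • (p.2 - p.1)‖ = ‖(p.1 + t • (p.2 - p.1)) - p.1‖ := by rw [add_sub_cancel_left]
      _ ≤ _ := (norm_sub_le _ _).trans (by gcongr; exact hR _ ht)
  nlinarith [norm_nonneg t]

theorem eventually_not_joinedIn_lineSlice {D : Set G} (hBdd : Bornology.IsBounded D) {a b : G}
    (hab : a ≠ b) {K₁ K₂ : Set ℂ} (h₁ : IsClosed K₁) (h₂ : IsClosed K₂) (hdisj : Disjoint K₁ K₂)
    (h : lineSlice (closure D) a b ⊆ K₁ ∪ K₂) (h0 : 0 ∈ K₁) (h1 : 1 ∈ K₂) :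
    ∀ᶠ p : G × G in 𝓝 (a, b), ¬ JoinedIn (lineSlice D p.1 p.2) 0 1 := by
  obtain ⟨U₁, U₂, hU₁, hU₂, hK₁, hK₂, hU⟩ := normal_separation h₁ h₂ hdisj
  filter_upwards [eventually_lineSlice_subset isClosed_closure hBdd.closure hab (hU₁.union hU₂)
    (h.trans (union_subset_union hK₁ hK₂))] with p hp hj
  obtain ⟨γ, hγ⟩ := hj
  have hsub : range γ ⊆ U₁ ∪ U₂ := by
    rintro _ ⟨t, rfl⟩
    exact hp (subset_closure (hγ t))
  have hconn : IsPreconnected (range γ) := isPreconnected_range γ.continuous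
  have := hconn.subset_left_of_subset_union hU₁ hU₂ hU hsub ⟨0, ⟨0, γ.source⟩, hK₁ h0⟩
  exact hU.le_bot ⟨this ⟨1, γ.target⟩, hK₂ h1⟩

variable {k : ℕ∞} {D U : Set G} {ρ : G → ℝ} {c : ℝ}

namespace IsSLCDefiningData

theorem contDiffAt (h : IsSLCDefiningData k D U ρ c) {z : G} (hz : z ∈ U) : ContDiffAt ℝ k ρ z :=
  h.2.2.1.contDiffAt (h.1.mem_nhds hz)

theorem mem_closure_iff (h : IsSLCDefiningData k D U ρ c) {z : G} (hz : z ∈ U) :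
    z ∈ closure D ↔ ρ z ≤ 0 := by
  obtain ⟨-, -, -, h0, hneg, -⟩ := h
  rw [closure_eq_self_union_frontier, mem_union, le_iff_lt_or_eq]
  refine or_congr ?_ ?_
  · simpa [hz] using Set.ext_iff.1 hneg z
  · simpa [hz] using Set.ext_iff.1 h0 z

theorem mem_iff (h : IsSLCDefiningData k D U ρ c) {z : G} (hz : z ∈ U) : z ∈ D ↔ ρ z < 0 := by
  simpa [hz] using Set.ext_iff.1 h.2.2.2.2.1 z

theorem eq_zero_of_mem_frontier (h : IsSLCDefiningData k D U ρ c) {z : G} (hz : z ∈ frontier D) :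
    ρ z = 0 := by
  rw [h.2.2.2.1] at hz
  exact hz.2

theorem eventually_notMem_closure_of_tangent (h : IsSLCDefiningData k D U ρ c) (hk : 2 ≤ k) {z : G}
    (hz : z ∈ frontier D) :
    ∀ᶠ y in 𝓝 z, wirtingerDeriv ρ z (y - z) = 0 → y ≠ z → y ∉ closure D := by
  have hzU := h.2.1 hz
  have h2 : ContDiffAt ℝ 2 ρ z := (h.contDiffAt hzU).of_le (WithTop.coe_le_coe.2 hk)
  have := h2.eventually_lt_of_secondDeriv_pos h.2.2.2.2.2.2.1
    (S := {X | wirtingerDeriv ρ z X = 0})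
    (fun X hX => ⟨(wirtingerDeriv_eq_zero_iff.1 hX).1, h.2.2.2.2.2.2.2 z hz X hX⟩)
  filter_upwards [this, h.1.mem_nhds hzU] with y hy hyU hw hne hcl
  have h1 := hy hw hne
  rw [h.eq_zero_of_mem_frontier hz] at h1
  exact h1.not_ge ((h.mem_closure_iff hyU).1 hcl)

theorem eventually_eq_of_mem_lineSlice_closure (h : IsSLCDefiningData k D U ρ c) (hk : 2 ≤ k)
    {a b : G} {t₀ : ℂ} (hz : a + t₀ • (b - a) ∈ frontier D)
    (hw : wirtingerDeriv ρ (a + t₀ • (b - a)) (b - a) = 0) (hab : a ≠ b) :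
    ∀ᶠ t in 𝓝 t₀, t ∈ lineSlice (closure D) a b → t = t₀ := by
  have hc : Continuous fun t : ℂ => a + t • (b - a) := by fun_prop
  filter_upwards [hc.continuousAt.eventually (h.eventually_notMem_closure_of_tangent hk hz)]
    with t ht hmem
  by_contra hne
  refine ht ?_ ?_ hmem
  · have : a + t • (b - a) - (a + t₀ • (b - a)) = (t - t₀) • (b - a) := by module
    rw [this]
    exact wirtingerDeriv_smul_eq_zero hw _
  · intro heq
    have := add_left_cancel heq
    exact hne (smul_left_injective ℂ (sub_ne_zero.2 hab.symm) this)

theorem contDiffAt_comp_line (h : IsSLCDefiningData k D U ρ c) {a v : G} {t₀ : ℂ}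
    (hz : a + t₀ • v ∈ U) : ContDiffAt ℝ k (fun t : ℂ => ρ (a + t • v)) t₀ :=
  ContDiffAt.comp t₀ (h.contDiffAt hz)
    (contDiffAt_const.add
      ((ContinuousLinearMap.toSpanSingleton ℂ v).restrictScalars ℝ).contDiff.contDiffAt)

theorem fderiv_comp_line (h : IsSLCDefiningData k D U ρ c) (hk : 2 ≤ k) {a v : G} {t₀ : ℂ}
    (hz : a + t₀ • v ∈ U) (e : ℂ) :
    fderiv ℝ (fun t : ℂ => ρ (a + t • v)) t₀ e = fderiv ℝ ρ (a + t₀ • v) (e • v) := by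
  let l : ℂ →L[ℝ] G := (ContinuousLinearMap.toSpanSingleton ℂ v).restrictScalars ℝ
  have hl : HasFDerivAt (fun t : ℂ => a + t • v) l t₀ := l.hasFDerivAt.const_add a
  have hρ : ContDiffAt ℝ 1 ρ (a + t₀ • v) :=
    (h.contDiffAt hz).of_le (WithTop.coe_le_coe.2 (one_le_two.trans hk))
  have := ((hρ.differentiableAt (by norm_num)).hasFDerivAt.comp t₀ hl).fderiv
  rw [show (fun t : ℂ => ρ (a + t • v)) = ρ ∘ fun t : ℂ => a + t • v from rfl, this]
  simp [l]

theorem wirtingerDeriv_eq_zero_of_line_disjoint (h : IsSLCDefiningData k D U ρ c) (hk : 2 ≤ k)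
    {a v : G} {t₀ : ℂ} (hz : a + t₀ • v ∈ frontier D) (hcon : ∀ t : ℂ, a + t • v ∉ D) :
    wirtingerDeriv ρ (a + t₀ • v) v = 0 := by
  by_contra hw
  obtain ⟨e, he⟩ := exists_fderiv_smul_neg hw
  have hc : Continuous fun t : ℂ => a + t • v := by fun_prop
  have hmin : IsLocalMin (fun t : ℂ => ρ (a + t • v)) t₀ := by
    filter_upwards [hc.continuousAt (h.1.mem_nhds (h.2.1 hz))] with t ht
    rw [h.eq_zero_of_mem_frontier hz]
    exact not_lt.1 fun hneg => hcon t ((h.mem_iff ht).2 hneg)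
  rw [← h.fderiv_comp_line hk (h.2.1 hz), hmin.fderiv_eq_zero] at he
  simp at he

theorem exists_nhds_joinedIn_lineSlice (h : IsSLCDefiningData k D U ρ c) (hk : 2 ≤ k)
    {a b : G} {t₀ : ℂ} (hz : a + t₀ • (b - a) ∈ frontier D)
    (hw : wirtingerDeriv ρ (a + t₀ • (b - a)) (b - a) ≠ 0) :
    ∃ V ∈ 𝓝 t₀, ∀ s ∈ V, ∀ t ∈ V, s ∈ lineSlice D a b → t ∈ lineSlice (closure D) a b →
      t ∈ closure {y | JoinedIn (lineSlice D a b) s y} := by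
  have hc : Continuous fun t : ℂ => a + t • (b - a) := by fun_prop
  obtain ⟨e, he⟩ := exists_fderiv_smul_neg hw
  have hf : ContDiffAt ℝ 1 (fun t : ℂ => ρ (a + t • (b - a))) t₀ :=
    (h.contDiffAt_comp_line (h.2.1 hz)).of_le (WithTop.coe_le_coe.2 (one_le_two.trans hk))
  have hf' : fderiv ℝ (fun t : ℂ => ρ (a + t • (b - a))) t₀ e < 0 := by
    rwa [h.fderiv_comp_line hk (h.2.1 hz)]
  have hWU : {t : ℂ | a + t • (b - a) ∈ U} ∈ 𝓝 t₀ := hc.continuousAt (h.1.mem_nhds (h.2.1 hz))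
  obtain ⟨V, hV, hVj⟩ := hf.exists_nhds_joinedIn_sublevel (h.eq_zero_of_mem_frontier hz) hf' hWU
  refine ⟨V ∩ _, inter_mem hV hWU, fun s hs t ht hsD htD => ?_⟩
  refine closure_mono ?_
    (hVj s hs.1 t ht.1 ((h.mem_iff hs.2).1 hsD) ((h.mem_closure_iff ht.2).1 htD))
  exact fun y hy => hy.mono fun u hu => (h.mem_iff hu.1).2 hu.2

theorem eventually_mem_closure_component (h : IsSLCDefiningData k D U ρ c) (hk : 2 ≤ k)
    (hD : IsOpen D) {a b : G} (hab : a ≠ b) {s t₀ : ℂ}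
    (ht₀ : t₀ ∈ closure {y | JoinedIn (lineSlice D a b) s y}) :
    ∀ᶠ t in 𝓝 t₀, t ∈ lineSlice (closure D) a b →
      t ∈ closure {y | JoinedIn (lineSlice D a b) s y} := by
  set A := {y | JoinedIn (lineSlice D a b) s y} with hA
  have hAopen : IsOpen A := (hD.lineSlice a b).pathComponentIn s
  have hAD : A ⊆ lineSlice D a b := fun y hy => hy.target_mem
  have ht₀cl : a + t₀ • (b - a) ∈ closure D :=
    closure_minimal (t := lineSlice (closure D) a b)
      (hAD.trans fun _ ht => subset_closure ht) (isClosed_closure.lineSlice a b) ht₀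
  by_cases hmem : a + t₀ • (b - a) ∈ D
  · obtain ⟨r, hr, hball⟩ := Metric.isOpen_iff.1 (hD.lineSlice a b) t₀ hmem
    obtain ⟨y, hyA, hy⟩ := Metric.mem_closure_iff.1 ht₀ r hr
    filter_upwards [Metric.ball_mem_nhds t₀ hr] with t ht _
    refine subset_closure (JoinedIn.trans hyA (JoinedIn.of_segment_subset ?_))
    exact ((convex_ball t₀ r).segment_subset (by rwa [Metric.mem_ball, dist_comm]) ht).trans hball
  · have hz : a + t₀ • (b - a) ∈ frontier D := ⟨ht₀cl, by rwa [hD.interior_eq]⟩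
    by_cases hw : wirtingerDeriv ρ (a + t₀ • (b - a)) (b - a) = 0
    · filter_upwards [h.eventually_eq_of_mem_lineSlice_closure hk hz hw hab] with t ht htD
      rwa [ht htD]
    · obtain ⟨V, hV, hVj⟩ := h.exists_nhds_joinedIn_lineSlice hk hz hw
      obtain ⟨y, hyV, hyA⟩ := mem_closure_iff_nhds.1 ht₀ V hV
      filter_upwards [hV] with t ht htD
      exact closure_mono (fun u hu => JoinedIn.trans hyA hu) (hVj y hyV t ht (hAD hyA) htD)

theorem joinedIn_lineSlice (h : IsSLCDefiningData k D U ρ c) (hk : 2 ≤ k) (hD : IsOpen D)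
    (hConn : IsPreconnected D) (hBdd : Bornology.IsBounded D) {a b : G} (ha : a ∈ D) (hb : b ∈ D) :
    JoinedIn (lineSlice D a b) 0 1 := by
  have hopen : IsOpen {b ∈ D | JoinedIn (lineSlice D a b) 0 1} := by
    rw [isOpen_iff_mem_nhds]
    rintro b ⟨hb, γ, hγ⟩
    have : ∀ᶠ b' in 𝓝 b, ∀ t ∈ range γ, a + t • (b' - a) ∈ D := by
      refine (isCompact_range γ.continuous).eventually_forall_of_forall_eventually ?_
      rintro _ ⟨t, rfl⟩
      have hc : Continuous fun q : G × ℂ => a + q.2 • (q.1 - a) := by fun_prop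
      exact hc.continuousAt.eventually (hD.mem_nhds (hγ t))
    filter_upwards [hD.mem_nhds hb, this] with b' hb' hj
    exact ⟨hb', γ, fun t => hj _ ⟨t, rfl⟩⟩
  have hclosed : IsOpen {b ∈ D | ¬ JoinedIn (lineSlice D a b) 0 1} := by
    rw [isOpen_iff_mem_nhds]
    rintro b ⟨hb, hnj⟩
    have hab : a ≠ b := by
      rintro rfl
      refine hnj (JoinedIn.of_segment_subset fun t _ => ?_)
      simpa [lineSlice] using ha
    set A := {y | JoinedIn (lineSlice D a b) 0 y} with hA
    have h0 : (0 : ℂ) ∈ closure A :=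
      subset_closure (JoinedIn.refl (zero_mem_lineSlice.2 ha))
    have h1 : (1 : ℂ) ∉ closure A := by
      intro hmem
      obtain ⟨r, hr, hball⟩ := Metric.isOpen_iff.1 (hD.lineSlice a b) 1 (one_mem_lineSlice.2 hb)
      obtain ⟨y, hyA, hy⟩ := Metric.mem_closure_iff.1 hmem r hr
      refine hnj (JoinedIn.trans hyA (JoinedIn.of_segment_subset ?_))
      exact ((convex_ball 1 r).segment_subset (by rwa [Metric.mem_ball, dist_comm])
        (Metric.mem_ball_self hr)).trans hball
    have hK₂ : IsClosed (lineSlice (closure D) a b \ closure A) := by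
      rw [← isOpen_compl_iff, isOpen_iff_mem_nhds]
      intro t ht
      by_cases htA : t ∈ closure A
      · filter_upwards [h.eventually_mem_closure_component hk hD hab htA] with u hu hu'
        exact hu'.2 (hu hu'.1)
      · have htD : t ∉ lineSlice (closure D) a b := fun htD => ht ⟨htD, htA⟩
        filter_upwards [(isClosed_closure.lineSlice a b).isOpen_compl.mem_nhds htD] with u hu hu'
        exact hu hu'.1
    have hev := eventually_not_joinedIn_lineSlice hBdd hab isClosed_closure hK₂
      disjoint_sdiff_right (by simp) h0 ⟨one_mem_lineSlice.2 (subset_closure hb), h1⟩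
    have hc : Continuous fun b' : G => (a, b') := by fun_prop
    filter_upwards [hD.mem_nhds hb, hc.continuousAt.eventually hev] with b' hb' hj
    exact ⟨hb', hj⟩
  have hsub : D ⊆ {b ∈ D | JoinedIn (lineSlice D a b) 0 1} := by
    refine hConn.subset_left_of_subset_union hopen hclosed ?_ ?_ ⟨a, ha, ha, ?_⟩
    · exact Set.disjoint_left.2 fun x hx hx' => hx'.2 hx.2
    · intro x hx
      by_cases hj : JoinedIn (lineSlice D a x) 0 1
      · exact Or.inl ⟨hx, hj⟩
      · exact Or.inr ⟨hx, hj⟩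
    · refine JoinedIn.of_segment_subset fun t _ => ?_
      simpa [lineSlice] using ha
  exact (hsub hb).2

/-- A complex line through two distinct points of the closure of a bounded strongly linearly convex
domain meets the domain. -/
theorem exists_line_point_mem (h : IsSLCDefiningData k D U ρ c) (hk : 2 ≤ k) (hD : IsOpen D)
    (hConn : IsPreconnected D) (hBdd : Bornology.IsBounded D) {a b : G} (ha : a ∈ closure D)
    (hb : b ∈ closure D) (hab : a ≠ b) : ∃ t : ℂ, a + t • (b - a) ∈ D := by
  by_contra! hcon
  have hiso : ∀ᶠ t in 𝓝 (0 : ℂ), t ∈ lineSlice (closure D) a b → t = 0 := by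
    have hz : a + (0 : ℂ) • (b - a) ∈ frontier D := by
      rw [zero_smul, add_zero]
      refine ⟨ha, ?_⟩
      have := hcon 0
      rwa [zero_smul, add_zero, ← hD.interior_eq] at this
    exact h.eventually_eq_of_mem_lineSlice_closure hk hz
      (h.wirtingerDeriv_eq_zero_of_line_disjoint hk hz hcon) hab
  have hK₂ : IsClosed (lineSlice (closure D) a b \ {0}) := by
    rw [← isOpen_compl_iff, isOpen_iff_mem_nhds]
    intro t ht
    by_cases ht0 : t = 0
    · rw [ht0]
      filter_upwards [hiso] with u hu hu'
      exact hu'.2 (hu hu'.1)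
    · have htD : t ∉ lineSlice (closure D) a b := fun htD => ht ⟨htD, ht0⟩
      filter_upwards [(isClosed_closure.lineSlice a b).isOpen_compl.mem_nhds htD] with u hu hu'
      exact hu hu'.1
  have hev := eventually_not_joinedIn_lineSlice hBdd hab isClosed_singleton hK₂
    disjoint_sdiff_right (by simp) (mem_singleton (0 : ℂ))
    ⟨one_mem_lineSlice.2 hb, one_ne_zero⟩
  have hmem : (a, b) ∈ closure (D ×ˢ D) := by
    rw [closure_prod_eq]
    exact ⟨ha, hb⟩
  obtain ⟨p, hp, hpD⟩ := mem_closure_iff_nhds.1 hmem _ hev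
  exact hp (h.joinedIn_lineSlice hk hD hConn hBdd hpD.1 hpD.2)

end IsSLCDefiningData

end ComplexLines

section VerticalCriticalPoints

variable {E F : Type*} [NormedAddCommGroup E] [NormedSpace ℝ E]
  [NormedAddCommGroup F] [NormedSpace ℝ F]

/-- The partial derivative of a function on `E × F` in the direction of the second factor. -/
noncomputable def verticalDeriv (ρ : E × F → ℝ) (z : E × F) : F →L[ℝ] ℝ :=
  fderiv ℝ ρ z ∘L ContinuousLinearMap.inr ℝ E F

/-- The Hessian of a function on `E × F` restricted to the second factor. -/
noncomputable def verticalHessian (ρ : E × F → ℝ) (z : E × F) : F →L[ℝ] (F →L[ℝ] ℝ) :=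
  fderiv ℝ (verticalDeriv ρ) z ∘L ContinuousLinearMap.inr ℝ E F

theorem verticalDeriv_eq_comp (ρ : E × F → ℝ) :
    verticalDeriv ρ =
      (ContinuousLinearMap.compL ℝ F (E × F) ℝ).flip (ContinuousLinearMap.inr ℝ E F) ∘
        fderiv ℝ ρ := rfl

theorem fderiv_verticalDeriv_apply {ρ : E × F → ℝ} {z : E × F}
    (h : DifferentiableAt ℝ (fderiv ℝ ρ) z) (X : E × F) (Y : F) :
    fderiv ℝ (verticalDeriv ρ) z X Y = fderiv ℝ (fderiv ℝ ρ) z X (0, Y) := by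
  rw [verticalDeriv_eq_comp, fderiv_comp _ (ContinuousLinearMap.differentiableAt _) h,
    ContinuousLinearMap.fderiv]
  simp

theorem ContDiffAt.verticalDeriv {n m : WithTop ℕ∞} {ρ : E × F → ℝ} {z : E × F}
    (h : ContDiffAt ℝ n ρ z) (hmn : m + 1 ≤ n) : ContDiffAt ℝ m (verticalDeriv ρ) z := by
  rw [verticalDeriv_eq_comp]
  exact (ContinuousLinearMap.contDiff _).contDiffAt.comp z (h.fderiv_right hmn)

/-- Near a nondegenerate family of vertical critical points, these points form the graph of a smooth
function. -/
theorem exists_graph_of_verticalDeriv_eq_zero [CompleteSpace E] [CompleteSpace F]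
    {n : WithTop ℕ∞} (hn : n ≠ 0) {ρ : E × F → ℝ} {N : Set (E × F)} (hN : IsOpen N)
    (hG : ∀ z ∈ N, ContDiffAt ℝ n (verticalDeriv ρ) z)
    (hinv : ∀ z ∈ N, (verticalHessian ρ z).IsInvertible)
    (hinj : ∀ z ∈ N, ∀ z' ∈ N, z.1 = z'.1 → verticalDeriv ρ z = 0 → verticalDeriv ρ z' = 0 →
      z = z') :
    IsOpen (Prod.fst '' {z ∈ N | verticalDeriv ρ z = 0}) ∧
    ∃ g : E → F, ∀ x ∈ Prod.fst '' {z ∈ N | verticalDeriv ρ z = 0},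
      (x, g x) ∈ N ∧ verticalDeriv ρ (x, g x) = 0 ∧ ContDiffAt ℝ n g x := by
  have hex : ∀ x, ∃ y, x ∈ Prod.fst '' {z ∈ N | verticalDeriv ρ z = 0} →
      (x, y) ∈ N ∧ verticalDeriv ρ (x, y) = 0 := by
    intro x
    by_cases hx : x ∈ Prod.fst '' {z ∈ N | verticalDeriv ρ z = 0}
    · obtain ⟨⟨x, y⟩, hz, rfl⟩ := hx
      exact ⟨y, fun _ => hz⟩
    · exact ⟨0, fun h => absurd h hx⟩
  choose g hg using hex
  have key : ∀ x ∈ Prod.fst '' {z ∈ N | verticalDeriv ρ z = 0},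
      ∃ ψ : E → F, ContDiffAt ℝ n ψ x ∧
        ∀ᶠ x' in 𝓝 x, (x', ψ x') ∈ {z ∈ N | verticalDeriv ρ z = 0} := by
    intro x hx
    obtain ⟨hxN, hx0⟩ := hg x hx
    have cdf := hG _ hxN
    have hi := hinv _ hxN
    have hψ := cdf.contDiffAt_implicitFunction hn hi
    refine ⟨cdf.implicitFunction hn hi, hψ, ?_⟩
    have hself := cdf.implicitFunction_apply_self hn hi
    have hc : ContinuousAt (fun x' => (x', cdf.implicitFunction hn hi x')) x :=
      continuousAt_id.prodMk hψ.continuousAt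
    have hmem : ∀ᶠ x' in 𝓝 x, (x', cdf.implicitFunction hn hi x') ∈ N := by
      refine hc.eventually (hN.mem_nhds ?_)
      have hpair : (x, cdf.implicitFunction hn hi x) = (x, g x) := congrArg (Prod.mk x) hself
      exact Set.mem_of_eq_of_mem hpair hxN
    filter_upwards [hmem, cdf.eventually_apply_implicitFunction hn hi] with x' h1 h2
    exact ⟨h1, h2.trans hx0⟩
  refine ⟨?_, g, fun x hx => ⟨(hg x hx).1, (hg x hx).2, ?_⟩⟩
  · rw [isOpen_iff_mem_nhds]
    intro x hx
    obtain ⟨ψ, -, hev⟩ := key x hx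
    filter_upwards [hev] with x' hx'
    exact ⟨_, hx', rfl⟩
  · obtain ⟨ψ, hψ, hev⟩ := key x hx
    refine hψ.congr_of_eventuallyEq ?_
    filter_upwards [hev] with x' hx'
    have hx'S : x' ∈ Prod.fst '' {z ∈ N | verticalDeriv ρ z = 0} := ⟨_, hx', rfl⟩
    have := hinj _ (hg x' hx'S).1 _ hx'.1 rfl (hg x' hx'S).2 hx'.2
    exact congrArg Prod.snd this

theorem eventually_eq_of_verticalDeriv_eq_zero [CompleteSpace E] [CompleteSpace F]
    {ρ : E × F → ℝ} {z : E × F} (hG : ContDiffAt ℝ 1 (verticalDeriv ρ) z)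
    (hinv : (verticalHessian ρ z).IsInvertible) (hz : verticalDeriv ρ z = 0) :
    ∀ᶠ p : (E × F) × (E × F) in 𝓝 (z, z),
      p.1.1 = p.2.1 → verticalDeriv ρ p.1 = 0 → verticalDeriv ρ p.2 = 0 → p.1 = p.2 := by
  have hev := hG.eventually_apply_eq_iff_implicitFunction one_ne_zero hinv
  filter_upwards [(continuous_fst.tendsto (z, z)).eventually hev,
    (continuous_snd.tendsto (z, z)).eventually hev] with p h1 h2 h h1' h2'
  have e1 := h1.1 (h1'.trans hz.symm)
  have e2 := h2.1 (h2'.trans hz.symm)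
  refine Prod.ext h ?_
  rw [← e1, ← e2, h]

theorem exists_isOpen_injOn_verticalDeriv_eq_zero [CompleteSpace E] [CompleteSpace F]
    {ρ : E × F → ℝ} {U Γ : Set (E × F)} (hU : IsOpen U) (hρ : ContDiffOn ℝ 2 ρ U)
    (hΓ : IsCompact Γ) (hΓU : Γ ⊆ U) (hΓ0 : ∀ z ∈ Γ, verticalDeriv ρ z = 0)
    (hΓinv : ∀ z ∈ Γ, (verticalHessian ρ z).IsInvertible)
    (hΓinj : ∀ z ∈ Γ, ∀ z' ∈ Γ, z.1 = z'.1 → z = z') :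
    ∃ N, IsOpen N ∧ Γ ⊆ N ∧ N ⊆ U ∧ (∀ z ∈ N, (verticalHessian ρ z).IsInvertible) ∧
      ∀ z ∈ N, ∀ z' ∈ N, z.1 = z'.1 → verticalDeriv ρ z = 0 → verticalDeriv ρ z' = 0 →
        z = z' := by
  have hG : ∀ z ∈ U, ContDiffAt ℝ 1 (verticalDeriv ρ) z := fun z hz =>
    (hρ.contDiffAt (hU.mem_nhds hz)).verticalDeriv (by norm_num)
  have e1 : ∀ᶠ z in 𝓝ˢ Γ, z ∈ U ∧ (verticalHessian ρ z).IsInvertible := by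
    rw [eventually_nhdsSet_iff_forall]
    intro z hz
    have hc : ContinuousAt (verticalHessian ρ) z :=
      ((hG z (hΓU hz)).fderiv_right (m := 0) (by norm_num)).continuousAt.clm_comp
        continuousAt_const
    filter_upwards [hU.mem_nhds (hΓU hz), hc.eventually
      (ContinuousLinearEquiv.isOpen.mem_nhds (hΓinv z hz))] with y h1 h2 using ⟨h1, h2⟩
  have e2 : ∀ᶠ p : (E × F) × (E × F) in 𝓝ˢ (Γ ×ˢ Γ),
      p.1.1 = p.2.1 → verticalDeriv ρ p.1 = 0 → verticalDeriv ρ p.2 = 0 → p.1 = p.2 := by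
    rw [eventually_nhdsSet_iff_forall]
    rintro ⟨z, z'⟩ ⟨hz, hz'⟩
    by_cases hne : z.1 = z'.1
    · obtain rfl := hΓinj z hz z' hz' hne
      exact eventually_eq_of_verticalDeriv_eq_zero (hG z (hΓU hz)) (hΓinv z hz) (hΓ0 z hz)
    · have hc : Continuous fun p : (E × F) × (E × F) => (p.1.1, p.2.1) := by fun_prop
      have hop : IsOpen {q : E × E | q.1 ≠ q.2} := isOpen_ne_fun continuous_fst continuous_snd
      filter_upwards [(hc.tendsto (z, z')).eventually (hop.mem_nhds hne)] with p hp h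
      exact absurd h hp
  rw [hΓ.nhdsSet_prod_eq hΓ] at e2
  obtain ⟨A, hA, B, hB, hAB⟩ := Filter.mem_prod_iff.1 e2
  obtain ⟨N, hN, hΓN, hNsub⟩ := mem_nhdsSet_iff_exists.1 (inter_mem e1 (inter_mem hA hB))
  exact ⟨N, hN, hΓN, fun z hz => (hNsub hz).1.1, fun z hz => (hNsub hz).1.2,
    fun z hz z' hz' => @hAB (z, z') ⟨(hNsub hz).2.1, (hNsub hz').2.2⟩⟩

theorem isInvertible_of_pos_def [FiniteDimensional ℝ F] {B : F →L[ℝ] (F →L[ℝ] ℝ)}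
    (hB : ∀ Y, Y ≠ 0 → 0 < B Y Y) : B.IsInvertible := by
  have hinj : Function.Injective (B : F →ₗ[ℝ] (F →L[ℝ] ℝ)) := by
    rw [injective_iff_map_eq_zero]
    intro Y hY
    by_contra hne
    have := hB Y hne
    rw [ContinuousLinearMap.coe_coe] at hY
    simp [hY] at this
  have hfin : Module.finrank ℝ F = Module.finrank ℝ (F →L[ℝ] ℝ) := by
    rw [← Subspace.dual_finrank_eq (K := ℝ) (V := F)]
    exact (LinearMap.toContinuousLinearMap (𝕜 := ℝ) (E := F) (F' := ℝ)).finrank_eq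
  refine ⟨(LinearMap.linearEquivOfInjective _ hinj hfin).toContinuousLinearEquiv, ?_⟩
  ext Y Y'
  rfl

section Envelope

variable {ρ : E × F → ℝ} {U : Set (E × F)} {S : Set E} {g : E → F}

theorem hasFDerivAt_critical_value {x : E} (hρ : DifferentiableAt ℝ ρ (x, g x))
    (hg : DifferentiableAt ℝ g x) (h0 : verticalDeriv ρ (x, g x) = 0) :
    HasFDerivAt (fun x => ρ (x, g x))
      (fderiv ℝ ρ (x, g x) ∘L ContinuousLinearMap.inl ℝ E F) x := by
  have h := hρ.hasFDerivAt.comp x ((hasFDerivAt_id x).prodMk hg.hasFDerivAt)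
  refine h.congr_fderiv ?_
  ext X
  have hX : fderiv ℝ ρ (x, g x) (0, fderiv ℝ g x X) = 0 :=
    DFunLike.congr_fun h0 (fderiv ℝ g x X)
  have : (X, fderiv ℝ g x X) = (X, 0) + (0, fderiv ℝ g x X) := by simp
  simp only [ContinuousLinearMap.comp_apply, ContinuousLinearMap.prod_apply,
    ContinuousLinearMap.id_apply, ContinuousLinearMap.inl_apply]
  rw [this, map_add, hX, add_zero]

/-- Replacing the second variable by a vertical critical point of class `C^n` does not lose
regularity. -/
theorem contDiffOn_critical_value {n : ℕ∞} (hn : n ≠ 0) (hU : IsOpen U)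
    (hρ : ContDiffOn ℝ (n + 1 : ℕ∞) ρ U) (hS : IsOpen S) (hgU : ∀ x ∈ S, (x, g x) ∈ U)
    (hg : ∀ x ∈ S, ContDiffAt ℝ n g x) (h0 : ∀ x ∈ S, verticalDeriv ρ (x, g x) = 0) :
    ContDiffOn ℝ (n + 1 : ℕ∞) (fun x => ρ (x, g x)) S := by
  have hn' : (n : WithTop ℕ∞) ≠ 0 := by exact_mod_cast hn
  have hcast : ((n + 1 : ℕ∞) : WithTop ℕ∞) = n + 1 := rfl
  have hder : ∀ x ∈ S, HasFDerivAt (fun x => ρ (x, g x))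
      (fderiv ℝ ρ (x, g x) ∘L ContinuousLinearMap.inl ℝ E F) x := fun x hx =>
    hasFDerivAt_critical_value
      ((hρ.contDiffAt (hU.mem_nhds (hgU x hx))).differentiableAt (by rw [hcast]; simp))
      ((hg x hx).differentiableAt hn') (h0 x hx)
  rw [hcast, contDiffOn_succ_iff_fderiv_of_isOpen hS]
  refine ⟨fun x hx => (hder x hx).differentiableAt.differentiableWithinAt, by simp, ?_⟩
  have : ContDiffOn ℝ n (fun x => fderiv ℝ ρ (x, g x) ∘L ContinuousLinearMap.inl ℝ E F) S := by
    intro x hx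
    refine ContDiffAt.contDiffWithinAt (ContDiffAt.clm_comp ?_ contDiffAt_const)
    exact ContDiffAt.comp x
      ((hρ.contDiffAt (hU.mem_nhds (hgU x hx))).fderiv_right (by rw [hcast]))
      (contDiffAt_id.prodMk (hg x hx))
  exact this.congr fun x hx => (hder x hx).fderiv

theorem fderiv_fderiv_critical_value (hU : IsOpen U) (hρ : ContDiffOn ℝ 2 ρ U) (hS : IsOpen S)
    (hgU : ∀ x ∈ S, (x, g x) ∈ U) (hg : ∀ x ∈ S, DifferentiableAt ℝ g x)
    (h0 : ∀ x ∈ S, verticalDeriv ρ (x, g x) = 0) {x : E} (hx : x ∈ S) (X : E) :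
    fderiv ℝ (fderiv ℝ fun x => ρ (x, g x)) x X X =
      fderiv ℝ (fderiv ℝ ρ) (x, g x) (X, fderiv ℝ g x X) (X, fderiv ℝ g x X) := by
  have hρ2 : ∀ x ∈ S, ContDiffAt ℝ 2 ρ (x, g x) := fun x hx =>
    hρ.contDiffAt (hU.mem_nhds (hgU x hx))
  have hd : DifferentiableAt ℝ (fderiv ℝ ρ) (x, g x) :=
    ((hρ2 x hx).fderiv_right (m := 1) (by norm_num)).differentiableAt (by norm_num)
  have hgr : HasFDerivAt (fun x => (x, g x))
      ((ContinuousLinearMap.id ℝ E).prod (fderiv ℝ g x)) x :=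
    (hasFDerivAt_id x).prodMk (hg x hx).hasFDerivAt
  have hcomp : HasFDerivAt (fun x => fderiv ℝ ρ (x, g x))
      (fderiv ℝ (fderiv ℝ ρ) (x, g x) ∘L (ContinuousLinearMap.id ℝ E).prod (fderiv ℝ g x)) x :=
    hd.hasFDerivAt.comp x hgr
  have hev : (fderiv ℝ fun x => ρ (x, g x)) =ᶠ[𝓝 x]
      fun x => (ContinuousLinearMap.compL ℝ E (E × F) ℝ).flip (ContinuousLinearMap.inl ℝ E F)
        (fderiv ℝ ρ (x, g x)) := by
    filter_upwards [hS.mem_nhds hx] with y hy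
    exact (hasFDerivAt_critical_value ((hρ2 y hy).differentiableAt (by norm_num)) (hg y hy)
      (h0 y hy)).fderiv
  have h1 := (((ContinuousLinearMap.compL ℝ E (E × F) ℝ).flip
    (ContinuousLinearMap.inl ℝ E F)).hasFDerivAt.comp x hcomp).fderiv
  have hev0 : (fun x => verticalDeriv ρ (x, g x)) =ᶠ[𝓝 x] fun _ => 0 := by
    filter_upwards [hS.mem_nhds hx] with y hy using h0 y hy
  have hdv : DifferentiableAt ℝ (verticalDeriv ρ) (x, g x) :=
    ((hρ2 x hx).verticalDeriv (m := 1) (by norm_num)).differentiableAt (by norm_num)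
  have h2 : fderiv ℝ (verticalDeriv ρ) (x, g x) (X, fderiv ℝ g x X) = 0 := by
    have e1 := (hdv.hasFDerivAt.comp x hgr).fderiv
    have e2 : fderiv ℝ (fun x => verticalDeriv ρ (x, g x)) x = 0 := by
      rw [hev0.fderiv_eq]; simp
    have := DFunLike.congr_fun (e1.symm.trans e2) X
    simpa using this
  have h3 := DFunLike.congr_fun h2 (fderiv ℝ g x X)
  rw [fderiv_verticalDeriv_apply hd] at h3
  rw [hev.fderiv_eq]
  have h4 := DFunLike.congr_fun (DFunLike.congr_fun h1 X) X
  refine h4.trans ?_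
  have : (X, fderiv ℝ g x X) = (X, 0) + (0, fderiv ℝ g x X) := by simp
  conv_rhs => rw [this]
  rw [map_add (fderiv ℝ (fderiv ℝ ρ) (x, g x) _), ← this, h3]
  simp

end Envelope

theorem verticalDeriv_eq_zero_of_isLocalMin {ρ : E × F → ℝ} {x : E} {y : F}
    (hρ : DifferentiableAt ℝ ρ (x, y)) (hmin : IsLocalMin (fun y => ρ (x, y)) y) :
    verticalDeriv ρ (x, y) = 0 := by
  have h := hρ.hasFDerivAt.comp y ((hasFDerivAt_const x y).prodMk (hasFDerivAt_id y))
  have h' := (h.fderiv).symm.trans hmin.fderiv_eq_zero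
  ext Y
  simpa [verticalDeriv] using DFunLike.congr_fun h' Y

theorem closure_image_fst [FiniteDimensional ℝ E] [FiniteDimensional ℝ F] {D : Set (E × F)}
    (hBdd : Bornology.IsBounded D) : closure (Prod.fst '' D) = Prod.fst '' closure D :=
  ((image_closure_subset_closure_image continuous_fst).antisymm
    (closure_minimal (image_mono subset_closure)
      (hBdd.isCompact_closure.image continuous_fst).isClosed)).symm

/-- The shadow of a bounded open set has a smooth defining function, with the convexity inherited in
a class of directions described by `J₁` and `J₂`, provided the fibres of the closure over points
outside of the shadow have at most one point. -/
theorem exists_definingFunction_image_fst [FiniteDimensional ℝ E] [FiniteDimensional ℝ F]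
    {n : ℕ∞} (hn : n ≠ 0) {D U : Set (E × F)} {ρ : E × F → ℝ} {c : ℝ} (hD : IsOpen D)
    (hBdd : Bornology.IsBounded D) (hU : IsOpen U) (hDU : frontier D ⊆ U)
    (hρ : ContDiffOn ℝ (n + 1 : ℕ∞) ρ U) (h0 : frontier D = {z ∈ U | ρ z = 0})
    (hneg : D ∩ U = {z ∈ U | ρ z < 0}) (hdρ : ∀ z ∈ U, fderiv ℝ ρ z ≠ 0) (hc : 0 < c)
    (J₁ : E → E) (J₂ : F → F) (hJ₁ : J₁ 0 = 0)
    (hpos : ∀ z ∈ frontier D, ∀ X : E × F, fderiv ℝ ρ z X = 0 →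
      fderiv ℝ ρ z (J₁ X.1, J₂ X.2) = 0 → c * ‖X‖ ^ 2 ≤ fderiv ℝ (fderiv ℝ ρ) z X X)
    (huniq : ∀ x ∉ Prod.fst '' D, ∀ y y', (x, y) ∈ closure D → (x, y') ∈ closure D → y = y') :
    ∃ (Ut : Set E) (ρt : E → ℝ), IsOpen Ut ∧ frontier (Prod.fst '' D) ⊆ Ut ∧
      ContDiffOn ℝ (n + 1 : ℕ∞) ρt Ut ∧ frontier (Prod.fst '' D) = {x ∈ Ut | ρt x = 0} ∧
      Prod.fst '' D ∩ Ut = {x ∈ Ut | ρt x < 0} ∧ (∀ x ∈ Ut, fderiv ℝ ρt x ≠ 0) ∧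
      ∀ x ∈ frontier (Prod.fst '' D), ∀ X : E, fderiv ℝ ρt x X = 0 →
        fderiv ℝ ρt x (J₁ X) = 0 → c * ‖X‖ ^ 2 ≤ fderiv ℝ (fderiv ℝ ρt) x X X := by
  have := FiniteDimensional.complete ℝ E
  have := FiniteDimensional.complete ℝ F
  have hn1 : (1 : ℕ∞) ≤ n := Order.one_le_iff_ne_zero.2 hn
  have hρ2 : ContDiffOn ℝ 2 ρ U := by
    refine hρ.of_le (WithTop.coe_le_coe.2 (?_ : (2 : ℕ∞) ≤ n + 1))
    rw [← one_add_one_eq_two]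
    gcongr
  have hρd : ∀ z ∈ U, DifferentiableAt ℝ ρ z := fun z hz =>
    (hρ2.contDiffAt (hU.mem_nhds hz)).differentiableAt (by norm_num)
  have mem_D : ∀ z ∈ U, (z ∈ D ↔ ρ z < 0) := fun z hz => by
    simpa [hz] using Set.ext_iff.1 hneg z
  have mem_fr : ∀ z ∈ U, (z ∈ frontier D ↔ ρ z = 0) := fun z hz => by
    simpa [hz] using Set.ext_iff.1 h0 z
  set P := Prod.fst '' D with hP
  have hPopen : IsOpen P := isOpenMap_fst D hD
  have hPcl : closure P = Prod.fst '' closure D := closure_image_fst hBdd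
  have hfr : ∀ x ∉ P, ∀ y, (x, y) ∈ closure D → (x, y) ∈ frontier D := fun x hx y hy =>
    ⟨hy, fun h => hx ⟨_, interior_subset h, rfl⟩⟩
  have hcrit : ∀ x ∉ P, ∀ y, (x, y) ∈ closure D → verticalDeriv ρ (x, y) = 0 := by
    intro x hx y hy
    have hz := hfr x hx y hy
    refine verticalDeriv_eq_zero_of_isLocalMin (hρd _ (hDU hz)) ?_
    have hcont : Continuous fun y' : F => (x, y') := by fun_prop
    filter_upwards [(hcont.tendsto y).eventually (hU.mem_nhds (hDU hz))] with y' hy'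
    rw [(mem_fr _ (hDU hz)).1 hz]
    exact not_lt.1 fun hlt => hx ⟨_, (mem_D _ hy').2 hlt, rfl⟩
  have hinv : ∀ x ∉ P, ∀ y, (x, y) ∈ closure D → (verticalHessian ρ (x, y)).IsInvertible := by
    intro x hx y hy
    have hz := hfr x hx y hy
    refine isInvertible_of_pos_def fun Y hY => ?_
    have hd : DifferentiableAt ℝ (fderiv ℝ ρ) (x, y) :=
      ((hρ2.contDiffAt (hU.mem_nhds (hDU hz))).fderiv_right (m := 1)
        (by norm_num)).differentiableAt (by norm_num)
    have hv : ∀ Y : F, fderiv ℝ ρ (x, y) (0, Y) = 0 := fun Y =>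
      DFunLike.congr_fun (hcrit x hx y hy) Y
    have h := hpos _ hz (0, Y) (hv Y) (by simpa [hJ₁] using hv (J₂ Y))
    have heq : verticalHessian ρ (x, y) Y Y = fderiv ℝ (fderiv ℝ ρ) (x, y) (0, Y) (0, Y) :=
      fderiv_verticalDeriv_apply hd (0, Y) Y
    rw [heq]
    have hY' : 0 < ‖((0, Y) : E × F)‖ := norm_pos_iff.2 (by simpa using hY)
    exact lt_of_lt_of_le (by positivity) h
  have hfrP : ∀ x ∈ frontier P, x ∉ P := fun x hx hxP => by
    rw [hPopen.frontier_eq] at hx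
    exact hx.2 hxP
  set Γ := closure D ∩ Prod.fst ⁻¹' frontier P with hΓ
  have hΓc : IsCompact Γ :=
    hBdd.isCompact_closure.inter_right (isClosed_frontier.preimage continuous_fst)
  obtain ⟨N, hN, hΓN, hNU, hNinv, hNinj⟩ := exists_isOpen_injOn_verticalDeriv_eq_zero hU hρ2 hΓc
    (fun z hz => hDU (hfr z.1 (hfrP _ hz.2) z.2 hz.1))
    (fun z hz => hcrit z.1 (hfrP _ hz.2) z.2 hz.1)
    (fun z hz => hinv z.1 (hfrP _ hz.2) z.2 hz.1)
    (fun z hz z' hz' h => Prod.ext h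
      (huniq z.1 (hfrP _ hz.2) z.2 z'.2 hz.1 (by rw [h]; exact hz'.1)))
  obtain ⟨hS, g, hg⟩ := exists_graph_of_verticalDeriv_eq_zero (n := n) (by exact_mod_cast hn) hN
    (fun z hz => (hρ.contDiffAt (hU.mem_nhds (hNU hz))).verticalDeriv le_rfl) hNinv hNinj
  set S := Prod.fst '' {z ∈ N | verticalDeriv ρ z = 0} with hSdef
  set Ut := S ∩ (Prod.fst '' (closure D \ N))ᶜ with hUt
  have hUtopen : IsOpen Ut := hS.inter
    ((hBdd.isCompact_closure.diff hN).image continuous_fst).isClosed.isOpen_compl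
  have hUtN : ∀ x ∈ Ut, ∀ y, (x, y) ∈ closure D → (x, y) ∈ N := fun x hx y hy => by
    by_contra hyN
    exact hx.2 ⟨_, ⟨hy, hyN⟩, rfl⟩
  have hfrΓ : ∀ x ∈ frontier P, ∃ y, (x, y) ∈ Γ := by
    intro x hx
    have hxcl : x ∈ closure P := frontier_subset_closure hx
    rw [hPcl] at hxcl
    obtain ⟨⟨x, y⟩, hz, rfl⟩ := hxcl
    exact ⟨y, hz, hx⟩
  have hfrUt : frontier P ⊆ Ut := by
    intro x hx
    refine ⟨?_, ?_⟩
    · obtain ⟨y, hy⟩ := hfrΓ x hx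
      exact ⟨_, ⟨hΓN hy, hcrit x (hfrP x hx) y hy.1⟩, rfl⟩
    · rintro ⟨z, hz, rfl⟩
      exact hz.2 (hΓN ⟨hz.1, hx⟩)
  have hgeq : ∀ x ∈ S, ∀ y, (x, y) ∈ N → verticalDeriv ρ (x, y) = 0 → g x = y :=
    fun x hx y hy hy0 =>
      congrArg Prod.snd (hNinj (x, g x) (hg x hx).1 (x, y) hy rfl (hg x hx).2.1 hy0)
  have hgU : ∀ x ∈ S, (x, g x) ∈ U := fun x hx => hNU (hg x hx).1
  have hgΓ : ∀ x ∈ frontier P, (x, g x) ∈ frontier D := by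
    intro x hx
    obtain ⟨y, hy⟩ := hfrΓ x hx
    rw [hgeq x (hfrUt hx).1 y (hΓN hy) (hcrit x (hfrP x hx) y hy.1)]
    exact hfr x (hfrP x hx) y hy.1
  have hnegP : ∀ x ∈ Ut, x ∈ P → ρ (x, g x) < 0 := by
    rintro x hx ⟨⟨x, y₀⟩, hy₀, rfl⟩
    have hcont : Continuous fun y : F => (x, y) := by fun_prop
    have hK : IsCompact {y : F | (x, y) ∈ closure D} := by
      have : {y : F | (x, y) ∈ closure D} = Prod.snd '' (closure D ∩ Prod.fst ⁻¹' {x}) := by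
        ext y
        simp
      rw [this]
      exact (hBdd.isCompact_closure.inter_right
        (isClosed_singleton.preimage continuous_fst)).image continuous_snd
    have hKN : ∀ y ∈ {y : F | (x, y) ∈ closure D}, (x, y) ∈ N := fun y hy => hUtN x hx y hy
    obtain ⟨y, hyK, hy⟩ := hK.exists_isMinOn (f := fun y => ρ (x, y)) ⟨y₀, subset_closure hy₀⟩
      (fun y hy => ((hρd _ (hNU (hKN y hy))).continuousAt.comp
        hcont.continuousAt).continuousWithinAt)
    have hlt : ρ (x, y) < 0 := lt_of_le_of_lt (hy (subset_closure hy₀))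
      ((mem_D _ (hNU (hKN y₀ (subset_closure hy₀)))).1 hy₀)
    have hyU := hNU (hKN y hyK)
    have hyD := (mem_D _ hyU).2 hlt
    have hmin : IsLocalMin (fun y => ρ (x, y)) y := by
      filter_upwards [(hcont.tendsto y).eventually (hD.mem_nhds hyD)] with y' hy'
      exact hy (subset_closure hy')
    have := hgeq x hx.1 y (hKN y hyK) (verticalDeriv_eq_zero_of_isLocalMin (hρd _ hyU) hmin)
    rwa [this]
  have hder : ∀ x ∈ S, HasFDerivAt (fun x => ρ (x, g x))
      (fderiv ℝ ρ (x, g x) ∘L ContinuousLinearMap.inl ℝ E F) x := fun x hx =>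
    hasFDerivAt_critical_value (hρd _ (hgU x hx))
      ((hg x hx).2.2.differentiableAt (by exact_mod_cast hn)) (hg x hx).2.1
  have happ : ∀ x ∈ S, ∀ X Y, fderiv ℝ ρ (x, g x) (X, Y) = fderiv ℝ (fun x => ρ (x, g x)) x X := by
    intro x hx X Y
    have hY : fderiv ℝ ρ (x, g x) (0, Y) = 0 := DFunLike.congr_fun (hg x hx).2.1 Y
    have hXY : (X, Y) = (X, 0) + (0, Y) := by simp
    rw [(hder x hx).fderiv, hXY, map_add, hY, add_zero]
    rfl
  refine ⟨Ut, fun x => ρ (x, g x), hUtopen, hfrUt, ?_, ?_, ?_, ?_, ?_⟩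
  · exact (contDiffOn_critical_value hn hU hρ hS hgU (fun x hx => (hg x hx).2.2)
      (fun x hx => (hg x hx).2.1)).mono inter_subset_left
  · ext x
    refine ⟨fun hx => ⟨hfrUt hx, (mem_fr _ (hDU (hgΓ x hx))).1 (hgΓ x hx)⟩, fun ⟨hx, hx0⟩ => ?_⟩
    have hz := (mem_fr _ (hgU x hx.1)).2 hx0
    rw [hPopen.frontier_eq, hPcl]
    exact ⟨⟨_, frontier_subset_closure hz, rfl⟩, fun hxP => (hnegP x hx hxP).ne hx0⟩
  · ext x
    exact ⟨fun hx => ⟨hx.2, hnegP x hx.2 hx.1⟩,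
      fun hx => ⟨⟨_, (mem_D _ (hgU x hx.1.1)).2 hx.2, rfl⟩, hx.1⟩⟩
  · intro x hx hzero
    refine hdρ _ (hgU x hx.1) ?_
    refine ContinuousLinearMap.ext fun ⟨X, Y⟩ => ?_
    rw [happ x hx.1, hzero]
    rfl
  · intro x hx X hX hJX
    have hxS := (hfrUt hx).1
    rw [fderiv_fderiv_critical_value hU hρ2 hS hgU
      (fun x hx => (hg x hx).2.2.differentiableAt (by exact_mod_cast hn))
      (fun x hx => (hg x hx).2.1) hxS]
    refine le_trans ?_ (hpos _ (hgΓ x hx) (X, fderiv ℝ g x X) ?_ ?_)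
    · have : ‖X‖ ≤ ‖(X, fderiv ℝ g x X)‖ := norm_fst_le (X, fderiv ℝ g x X)
      gcongr
    · rw [happ x hxS, hX]
    · rw [happ x hxS, hJX]

end VerticalCriticalPoints

/-- Let `D ⊆ ℂ^{n+m} = ℂⁿ × ℂᵐ` be a `C^k`-smooth strongly linearly convex bounded domain
with `k ≥ 2`, and let `π = Prod.fst` be the projection onto the first `n` coordinates.
Then the shadow `π(D)` is a `C^k`-smooth strongly linearly convex bounded domain in ℂⁿ. -/
theorem shadow_stronglyLinearlyConvex {n m : ℕ} (k : ℕ∞) (hk : 2 ≤ k)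
    (D : Set (EuclideanSpace ℂ (Fin n) × EuclideanSpace ℂ (Fin m)))
    (hOpen : IsOpen D) (hConn : IsConnected D) (hBdd : Bornology.IsBounded D)
    (U : Set (EuclideanSpace ℂ (Fin n) × EuclideanSpace ℂ (Fin m)))
    (ρ : EuclideanSpace ℂ (Fin n) × EuclideanSpace ℂ (Fin m) → ℝ) (c : ℝ)
    (hSLC : IsSLCDefiningData k D U ρ c) :
    (IsOpen (Prod.fst '' D) ∧ IsConnected (Prod.fst '' D) ∧
      Bornology.IsBounded (Prod.fst '' D)) ∧
    ∃ (Ut : Set (EuclideanSpace ℂ (Fin n))) (ρt : EuclideanSpace ℂ (Fin n) → ℝ) (ct : ℝ),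
      IsSLCDefiningData k (Prod.fst '' D) Ut ρt ct := by
  obtain ⟨n, hn, rfl⟩ : ∃ n : ℕ∞, n ≠ 0 ∧ k = n + 1 := by
    refine ⟨k - 1, ?_, (tsub_add_cancel_of_le (one_le_two.trans hk)).symm⟩
    rw [Ne, tsub_eq_zero_iff_le, not_le]
    exact lt_of_lt_of_le (by norm_num) hk
  have huniq : ∀ x ∉ Prod.fst '' D, ∀ y y', (x, y) ∈ closure D → (x, y') ∈ closure D → y = y' := by
    intro x hx y y' hy hy'
    by_contra hne
    obtain ⟨t, ht⟩ := hSLC.exists_line_point_mem hk hOpen hConn.isPreconnected hBdd hy hy'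
      (fun h => hne (congrArg Prod.snd h))
    exact hx ⟨_, ht, by simp⟩
  obtain ⟨hU, hDU, hρ, h0, hneg, hdρ, hc, hpos⟩ := hSLC
  obtain ⟨Ut, ρt, hUt, hPUt, hρt, h0t, hnegt, hdρt, hpost⟩ :=
    exists_definingFunction_image_fst hn hOpen hBdd hU hDU hρ h0 hneg hdρ hc
      (fun X => Complex.I • X) (fun Y => Complex.I • Y) (smul_zero _)
      (fun z hz X hX hIX => hpos z hz X (wirtingerDeriv_eq_zero_iff.2 ⟨hX, hIX⟩)) huniq
  exact ⟨⟨isOpenMap_fst D hOpen, hConn.image _ continuous_fst.continuousOn, hBdd.image_fst⟩,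
    Ut, ρt, c, hUt, hPUt, hρt, h0t, hnegt, hdρt, hc, fun x hx X hX =>
      hpost x hx X (wirtingerDeriv_eq_zero_iff.1 hX).1 (wirtingerDeriv_eq_zero_iff.1 hX).2⟩
end
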